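/- arXiv:2106.11235 — 4 statements merged into one kernel-verified Lean document; each statement's English description precedes it below -/
import Mathlib

section
/- Assume (B1)–(B3). For ρ ∈ ℝ let u(·,ρ) be the unique continuous solution of u(r) = ρ − ∫₀^r t^{−α/(β+1)} ( ∫₀^t s^γ e^{f(u(s))} ds )^{1/(β+1)} dt. Then: (i) for every B ≥ 0 and every ρ > B there exists a unique R(B,ρ) > 0 with u(R(B,ρ),ρ) = B; (ii) for every B ≥ 0 there exist positive constants R̲(B) and R̄(B) and a number ρ₀(B) > B, all depending only on B (and the data α, β, γ, f), such that R̲(B) ≤ R(B,ρ) ≤ R̄(B) for all ρ ≥ ρ₀(B); moreover the upper bound R(B,ρ) ≤ R̄(B) holds for all ρ ≥ B. -/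
open Filter Set Real

/-- Differential form of the radial problem: `w` is the weighted integral of the source term and
`U' = -t^{-α/b} w^{1/b}`. -/
structure IsRegularSolution (α b γ ρ : ℝ) (f U w : ℝ → ℝ) : Prop where
  continuousOn : ContinuousOn U (Ici 0)
  map_zero : U 0 = ρ
  hasDerivAt : ∀ t, 0 < t → HasDerivAt U (-(t ^ (-(α / b)) * w t ^ (1 / b))) t
  hasDerivAt_flux : ∀ t, 0 < t → HasDerivAt w (t ^ γ * exp (f (U t))) t
  flux_pos : ∀ t, 0 < t → 0 < w t
  strictAntiOn : StrictAntiOn U (Ici 0)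
  le_flux : ∀ t, 0 < t → exp (f (U t)) * (t ^ (γ + 1) / (γ + 1)) ≤ w t
  flux_le : ∀ t, 0 < t → w t ≤ exp (f ρ) * (t ^ (γ + 1) / (γ + 1))
  flux_le_add : ∀ s t, 0 < s → s ≤ t →
    w t ≤ w s + exp (f (U s)) * (t ^ (γ + 1) / (γ + 1))

theorem intervalIntegrable_rpow_mul_exp {γ : ℝ} (hγ : -1 < γ) {f U : ℝ → ℝ} (hf : Continuous f)
    (hU : ContinuousOn U (Ici 0)) {s t : ℝ} (hs : 0 ≤ s) (ht : 0 ≤ t) :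
    IntervalIntegrable (fun x => x ^ γ * exp (f (U x))) MeasureTheory.volume s t := by
  apply IntervalIntegrable.mul_continuousOn (intervalIntegral.intervalIntegrable_rpow' hγ)
  apply (continuous_exp.comp hf).comp_continuousOn (hU.mono _)
  intro x hx
  exact (le_min hs ht).trans hx.1

theorem hasDerivAt_integral_rpow_mul_exp {γ : ℝ} (hγ : -1 < γ) {f U : ℝ → ℝ} (hf : Continuous f)
    (hU : ContinuousOn U (Ici 0)) {t : ℝ} (ht : 0 < t) :
    HasDerivAt (fun t => ∫ x in (0 : ℝ)..t, x ^ γ * exp (f (U x))) (t ^ γ * exp (f (U t))) t := by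
  have hc : ContinuousOn (fun x => x ^ γ * exp (f (U x))) (Ioi 0) := by
    apply ContinuousOn.mul
    · exact fun x hx => (continuousAt_rpow_const x γ (Or.inl (ne_of_gt hx))).continuousWithinAt
    · exact (continuous_exp.comp hf).comp_continuousOn (hU.mono Ioi_subset_Ici_self)
  exact intervalIntegral.integral_hasDerivAt_right
    (intervalIntegrable_rpow_mul_exp hγ hf hU le_rfl ht.le)
    (hc.stronglyMeasurableAtFilter isOpen_Ioi t ht) (hc.continuousAt (Ioi_mem_nhds ht))

theorem integral_rpow_mul_exp_le {γ : ℝ} (hγ : -1 < γ) {f U : ℝ → ℝ} (hf : Continuous f)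
    (hU : ContinuousOn U (Ici 0)) {s t M : ℝ} (hs : 0 ≤ s) (hst : s ≤ t)
    (hM : ∀ x ∈ Icc s t, exp (f (U x)) ≤ M) :
    (∫ x in s..t, x ^ γ * exp (f (U x))) ≤ M * ((t ^ (γ + 1) - s ^ (γ + 1)) / (γ + 1)) := by
  rw [← integral_rpow (Or.inl hγ), ← intervalIntegral.integral_const_mul]
  apply intervalIntegral.integral_mono_on hst
    (intervalIntegrable_rpow_mul_exp hγ hf hU hs (hs.trans hst))
    ((intervalIntegral.intervalIntegrable_rpow' hγ).const_mul M)
  intro x hx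
  rw [mul_comm]
  exact mul_le_mul_of_nonneg_right (hM x hx) (rpow_nonneg (hs.trans hx.1) _)

theorem le_integral_rpow_mul_exp {γ : ℝ} (hγ : -1 < γ) {f U : ℝ → ℝ} (hf : Continuous f)
    (hU : ContinuousOn U (Ici 0)) {t M : ℝ} (ht : 0 ≤ t)
    (hM : ∀ x ∈ Icc 0 t, M ≤ exp (f (U x))) :
    M * (t ^ (γ + 1) / (γ + 1)) ≤ ∫ x in (0 : ℝ)..t, x ^ γ * exp (f (U x)) := by
  have h0 : t ^ (γ + 1) / (γ + 1) = (t ^ (γ + 1) - 0 ^ (γ + 1)) / (γ + 1) := by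
    rw [zero_rpow (by linarith), sub_zero]
  rw [h0, ← integral_rpow (Or.inl hγ), ← intervalIntegral.integral_const_mul]
  apply intervalIntegral.integral_mono_on ht
    ((intervalIntegral.intervalIntegrable_rpow' hγ).const_mul M)
    (intervalIntegrable_rpow_mul_exp hγ hf hU le_rfl ht)
  intro x hx
  rw [mul_comm]
  exact mul_le_mul_of_nonneg_left (hM x hx) (rpow_nonneg hx.1 _)

theorem rpow_neg_mul_rpow_source {α b γ t M : ℝ} (hb : 0 < b) (hγ : 0 < γ + 1) (ht : 0 < t)
    (hM : 0 ≤ M) :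
    t ^ (-(α / b)) * (M * (t ^ (γ + 1) / (γ + 1))) ^ (1 / b) =
      (M / (γ + 1)) ^ (1 / b) * t ^ ((γ + 1 + b - α) / b - 1) := by
  have h1 : M * (t ^ (γ + 1) / (γ + 1)) = (M / (γ + 1)) * t ^ (γ + 1) := by ring
  rw [h1, mul_rpow (by positivity) (by positivity), ← rpow_mul ht.le, mul_left_comm,
    ← rpow_add ht]
  congr 2
  field_simp
  ring

theorem IsRegularSolution.of_integral_eq {α b γ ρ : ℝ} {f U : ℝ → ℝ} (hf : Continuous f)
    (hmono : StrictMono f) (hαb : b < α) (hb : 0 < b) (hθ : 0 < γ + 1 + b - α)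
    (hU : ContinuousOn U (Ici 0))
    (heq : ∀ r, 0 ≤ r → U r = ρ - ∫ t in (0 : ℝ)..r, t ^ (-(α / b)) *
      (∫ s in (0 : ℝ)..t, s ^ γ * exp (f (U s))) ^ (1 / b)) :
    IsRegularSolution α b γ ρ f U (fun t => ∫ s in (0 : ℝ)..t, s ^ γ * exp (f (U s))) := by
  have hγ : -1 < γ := by linarith
  have hγ1 : 0 < γ + 1 := by linarith
  set w : ℝ → ℝ := fun t => ∫ s in (0 : ℝ)..t, s ^ γ * exp (f (U s)) with hw
  have hwd : ∀ t, 0 < t → HasDerivAt w (t ^ γ * exp (f (U t))) t := fun t ht =>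
    hasDerivAt_integral_rpow_mul_exp hγ hf hU ht
  have hwpos : ∀ t, 0 < t → 0 < w t := by
    intro t ht
    apply intervalIntegral.intervalIntegral_pos_of_pos_on
      (intervalIntegrable_rpow_mul_exp hγ hf hU le_rfl ht.le) _ ht
    intro x hx
    exact mul_pos (rpow_pos_of_pos hx.1 _) (exp_pos _)
  have hhc : ContinuousOn (fun t => t ^ (-(α / b)) * w t ^ (1 / b)) (Ioi 0) := by
    intro t ht
    exact ((continuousAt_rpow_const t _ (Or.inl (ne_of_gt ht))).mul
      ((hwd t ht).continuousAt.rpow_const (Or.inl (hwpos t ht).ne'))).continuousWithinAt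
  have hhi : ∀ r, 0 < r →
      IntervalIntegrable (fun t => t ^ (-(α / b)) * w t ^ (1 / b)) MeasureTheory.volume 0 r := by
    intro r hr
    obtain ⟨M, hM⟩ := (isCompact_Icc (a := (0 : ℝ)) (b := r)).bddAbove_image
      ((continuous_exp.comp hf).comp_continuousOn (hU.mono Icc_subset_Ici_self))
    have hM' : ∀ x ∈ Icc 0 r, exp (f (U x)) ≤ M := fun x hx => hM (mem_image_of_mem _ hx)
    have hM0 : 0 ≤ M := (exp_pos _).le.trans (hM' 0 ⟨le_rfl, hr.le⟩)
    have hint : IntervalIntegrable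
        (fun t : ℝ => (M / (γ + 1)) ^ (1 / b) * t ^ ((γ + 1 + b - α) / b - 1))
        MeasureTheory.volume 0 r := by
      apply (intervalIntegral.intervalIntegrable_rpow' _).const_mul
      have : 0 < (γ + 1 + b - α) / b := by positivity
      linarith
    apply hint.mono_fun
    · rw [uIoc_of_le hr.le]
      exact (hhc.mono Ioc_subset_Ioi_self).aestronglyMeasurable measurableSet_Ioc
    · rw [uIoc_of_le hr.le]
      filter_upwards [MeasureTheory.ae_restrict_mem measurableSet_Ioc] with t ht
      have h1 : 0 ≤ t ^ (-(α / b)) := rpow_nonneg ht.1.le _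
      have h2 := integral_rpow_mul_exp_le hγ hf hU le_rfl ht.1.le
        (fun x hx => hM' x ⟨hx.1, hx.2.trans ht.2⟩)
      rw [zero_rpow hγ1.ne', sub_zero] at h2
      rw [← rpow_neg_mul_rpow_source hb hγ1 ht.1 hM0]
      refine (norm_of_nonneg (mul_nonneg h1 (rpow_nonneg (hwpos t ht.1).le _))).trans_le
        (le_trans ?_ (le_norm_self _))
      exact mul_le_mul_of_nonneg_left
        (rpow_le_rpow (hwpos t ht.1).le h2 (by positivity)) h1
  have hUd : ∀ t, 0 < t → HasDerivAt U (-(t ^ (-(α / b)) * w t ^ (1 / b))) t := by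
    intro t ht
    have h1 := (intervalIntegral.integral_hasDerivAt_right (hhi t ht)
      (hhc.stronglyMeasurableAtFilter isOpen_Ioi t ht)
      (hhc.continuousAt (Ioi_mem_nhds ht))).const_sub ρ
    apply h1.congr_of_eventuallyEq
    filter_upwards [Ioi_mem_nhds ht] with r hr
    exact heq r (le_of_lt hr)
  have hanti : StrictAntiOn U (Ici 0) := by
    apply strictAntiOn_of_deriv_neg (convex_Ici 0) hU
    intro t ht
    rw [interior_Ici] at ht
    rw [(hUd t ht).deriv]
    exact neg_neg_of_pos (mul_pos (rpow_pos_of_pos ht _) (rpow_pos_of_pos (hwpos t ht) _))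
  have h0 : U 0 = ρ := by rw [heq 0 le_rfl]; simp
  have hle : ∀ s x, 0 ≤ s → s ≤ x → exp (f (U x)) ≤ exp (f (U s)) := fun s x hs hx =>
    exp_le_exp.2 (hmono.monotone (hanti.antitoneOn hs (hs.trans hx) hx))
  refine ⟨hU, h0, hUd, hwd, hwpos, hanti, ?_, ?_, ?_⟩
  · intro t ht
    exact le_integral_rpow_mul_exp hγ hf hU ht.le (fun x hx => hle x t hx.1 hx.2)
  · intro t ht
    have h2 := integral_rpow_mul_exp_le hγ hf hU le_rfl ht.le
      (fun x hx => hle 0 x le_rfl hx.1)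
    rwa [zero_rpow hγ1.ne', sub_zero, h0] at h2
  · intro s t hs hst
    have h2 := integral_rpow_mul_exp_le hγ hf hU hs.le hst (fun x hx => hle s x hs.le hx.1)
    have h3 : w s + ∫ x in s..t, x ^ γ * exp (f (U x)) = w t :=
      intervalIntegral.integral_add_adjacent_intervals
        (intervalIntegrable_rpow_mul_exp hγ hf hU le_rfl hs.le)
        (intervalIntegrable_rpow_mul_exp hγ hf hU hs.le (hs.le.trans hst))
    rw [← h3]
    gcongr
    refine h2.trans ?_
    gcongr
    linarith [rpow_nonneg hs.le (γ + 1)]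

/-- If `e^{f/b}` dominates `H (v + σ) ^ N` above the level `U r`, then separating variables in
`-U' ≥ c t^{θ/b-1} e^{f(U)/b}` bounds `r` independently of the initial height. -/
theorem IsRegularSolution.rpow_le_of_growth {α b γ ρ : ℝ} {f U w : ℝ → ℝ}
    (h : IsRegularSolution α b γ ρ f U w) (hb : 0 < b) (hγ : 0 < γ + 1)
    (hθ : 0 < γ + 1 + b - α) {N H σ r : ℝ} (hN : 1 < N) (hr : 0 < r)
    (hpos : 0 < U r + σ) (hH : ∀ v, U r ≤ v → H * (v + σ) ^ N ≤ exp (f v / b)) :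
    (N - 1) * H * ((1 / (γ + 1)) ^ (1 / b) * (b / (γ + 1 + b - α))) *
      r ^ ((γ + 1 + b - α) / b) ≤ (U r + σ) ^ (1 - N) := by
  set θ := γ + 1 + b - α with hθdef
  have hge : ∀ t, 0 ≤ t → t ≤ r → U r ≤ U t := fun t h0 ht =>
    h.strictAntiOn.antitoneOn h0 hr.le ht
  have hp : ∀ t, 0 ≤ t → t ≤ r → 0 < U t + σ := fun t h0 ht => by linarith [hge t h0 ht]
  set c := (1 / (γ + 1)) ^ (1 / b) with hc
  have hcpos : 0 < c := by positivity
  have hmono : MonotoneOn (fun t => (U t + σ) ^ (1 - N) - (N - 1) * H * (c * (b / θ)) * t ^ (θ / b))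
      (Icc 0 r) := by
    have hd : ∀ t ∈ Ioo 0 r, HasDerivAt
        (fun t => (U t + σ) ^ (1 - N) - (N - 1) * H * (c * (b / θ)) * t ^ (θ / b))
        (-(t ^ (-(α / b)) * w t ^ (1 / b)) * (1 - N) * (U t + σ) ^ (1 - N - 1) -
          (N - 1) * H * (c * (b / θ)) * ((θ / b) * t ^ (θ / b - 1))) t := by
      intro t ht
      exact (((h.hasDerivAt t ht.1).add_const σ).rpow_const
        (Or.inl (hp t ht.1.le ht.2.le).ne')).sub
        ((hasDerivAt_rpow_const (Or.inl ht.1.ne')).const_mul _)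
    apply monotoneOn_of_deriv_nonneg (convex_Icc 0 r)
    · apply ContinuousOn.sub
      · apply ContinuousOn.rpow_const
        · exact (h.continuousOn.mono Icc_subset_Ici_self).add continuousOn_const
        · exact fun t ht => Or.inl (hp t ht.1 ht.2).ne'
      · exact (continuous_const.mul (continuous_rpow_const (by positivity))).continuousOn
    · rw [interior_Icc]
      exact fun t ht => (hd t ht).differentiableAt.differentiableWithinAt
    · rw [interior_Icc]
      intro t ht
      rw [(hd t ht).deriv]
      have h1 : c * exp (f (U t) / b) * t ^ (θ / b - 1) ≤ t ^ (-(α / b)) * w t ^ (1 / b) := by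
        have h2 := rpow_neg_mul_rpow_source (α := α) hb hγ ht.1 (exp_pos (f (U t))).le
        have h3 : (exp (f (U t)) / (γ + 1)) ^ (1 / b) = c * exp (f (U t) / b) := by
          rw [div_eq_mul_one_div, mul_comm, mul_rpow (by positivity) (exp_pos _).le, ← exp_mul]
          congr 2
          ring
        rw [h3] at h2
        rw [← h2]
        have := rpow_pos_of_pos ht.1 (γ + 1)
        exact mul_le_mul_of_nonneg_left (rpow_le_rpow (by positivity) (h.le_flux t ht.1)
          (by positivity)) (rpow_nonneg ht.1.le _)
      have h4 := hH (U t) (hge t ht.1.le ht.2.le)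
      have hP := hp t ht.1.le ht.2.le
      have ht1 : 0 < t ^ (θ / b - 1) := rpow_pos_of_pos ht.1 _
      have h5 : H ≤ exp (f (U t) / b) * (U t + σ) ^ (1 - N - 1) := by
        have : (U t + σ) ^ N * (U t + σ) ^ (1 - N - 1) = 1 := by
          rw [← rpow_add hP]; simp
        calc H = H * (U t + σ) ^ N * (U t + σ) ^ (1 - N - 1) := by rw [mul_assoc, this, mul_one]
          _ ≤ _ := mul_le_mul_of_nonneg_right h4 (rpow_nonneg hP.le _)
      have h6 : c * H * t ^ (θ / b - 1) ≤
          (t ^ (-(α / b)) * w t ^ (1 / b)) * (U t + σ) ^ (1 - N - 1) := by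
        calc c * H * t ^ (θ / b - 1)
            ≤ c * (exp (f (U t) / b) * (U t + σ) ^ (1 - N - 1)) * t ^ (θ / b - 1) := by gcongr
          _ = c * exp (f (U t) / b) * t ^ (θ / b - 1) * (U t + σ) ^ (1 - N - 1) := by ring
          _ ≤ _ := mul_le_mul_of_nonneg_right h1 (rpow_nonneg hP.le _)
      have h7 : (N - 1) * H * (c * (b / θ)) * ((θ / b) * t ^ (θ / b - 1)) =
          (N - 1) * (c * H * t ^ (θ / b - 1)) := by field_simp
      rw [h7]
      have := mul_le_mul_of_nonneg_left h6 (sub_nonneg.2 hN.le)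
      linarith
  have h8 := hmono ⟨le_rfl, hr.le⟩ ⟨hr.le, le_rfl⟩ hr.le
  simp only [zero_rpow (div_pos hθ hb).ne', mul_zero, sub_zero] at h8
  have := rpow_nonneg (hp 0 le_rfl hr.le).le (1 - N)
  linarith

theorem exists_forall_exp_growth {f : ℝ → ℝ} {b : ℝ} (hb : 0 < b) (hf : Differentiable ℝ f)
    (hB : Tendsto (fun u => u * deriv f u) atTop atTop) (N : ℝ) :
    ∃ A₀, 0 < A₀ ∧ ∀ A v, A₀ ≤ A → A ≤ v → exp (f A / b) * (v / A) ^ N ≤ exp (f v / b) := by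
  obtain ⟨a, ha⟩ := eventually_atTop.1 (hB.eventually_ge_atTop (N * b))
  refine ⟨max a 1, by positivity, ?_⟩
  have hpos : ∀ x, max a 1 ≤ x → 0 < x := fun x hx =>
    lt_of_lt_of_le one_pos ((le_max_right a 1).trans hx)
  have hmono : MonotoneOn (fun x => f x - N * b * log x) (Ici (max a 1)) := by
    have hd : ∀ x ∈ Ici (max a 1), HasDerivAt (fun x => f x - N * b * log x)
        (deriv f x - N * b * x⁻¹) x := fun x hx =>
      (hf x).hasDerivAt.sub ((hasDerivAt_log (hpos x hx).ne').const_mul _)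
    apply monotoneOn_of_deriv_nonneg (convex_Ici _)
    · exact fun x hx => (hd x hx).continuousAt.continuousWithinAt
    · exact fun x hx => (hd x (interior_subset hx)).differentiableAt.differentiableWithinAt
    · intro x hx
      have hx' := interior_subset hx
      rw [(hd x hx').deriv]
      have h1 := ha x ((le_max_left a 1).trans hx')
      have h2 := hpos x hx'
      rw [sub_nonneg, ← div_eq_mul_inv, div_le_iff₀ h2]
      linarith
  intro A v hA hv
  have h1 := hmono hA (hA.trans hv) hv
  have hA0 := hpos A hA
  have hv0 := hpos v (hA.trans hv)
  simp only at h1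
  rw [rpow_def_of_pos (div_pos hv0 hA0), ← exp_add, exp_le_exp, log_div hv0.ne' hA0.ne',
    ← sub_nonneg]
  have h2 : f v / b - (f A / b + (log v - log A) * N) =
      ((f v - N * b * log v) - (f A - N * b * log A)) / b := by field_simp; ring
  rw [h2]
  exact div_nonneg (by linarith) hb.le

theorem exists_radius_bound {α b γ : ℝ} {f : ℝ → ℝ} (hb : 0 < b) (hγ : 0 < γ + 1)
    (hθ : 0 < γ + 1 + b - α) (hf : Differentiable ℝ f) (hmono : StrictMono f)
    (hB : Tendsto (fun u => u * deriv f u) atTop atTop) :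
    ∃ R, 0 < R ∧ ∀ ρ U w, IsRegularSolution α b γ ρ f U w → ∀ r, 0 < r → 0 ≤ U r → r ≤ R := by
  obtain ⟨A, hA, hgrow⟩ := exists_forall_exp_growth hb hf hB 2
  set H := exp (f 0 / b) / (A + 1) ^ (2 : ℝ) with hHdef
  have hH0 : 0 < H := by positivity
  have hH : ∀ v, 0 ≤ v → H * (v + 1) ^ (2 : ℝ) ≤ exp (f v / b) := by
    intro v hv
    have hle : ∀ x, 0 ≤ x → exp (f 0 / b) ≤ exp (f x / b) := fun x hx =>
      exp_le_exp.2 (div_le_div_of_nonneg_right (hmono.monotone hx) hb.le)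
    have h1 : H * (v + 1) ^ (2 : ℝ) = exp (f 0 / b) * ((v + 1) / (A + 1)) ^ (2 : ℝ) := by
      rw [div_rpow (by positivity) (by positivity), hHdef]; ring
    rw [h1]
    rcases le_total v A with hvA | hvA
    · refine le_trans (mul_le_of_le_one_right (exp_pos _).le ?_) (hle v hv)
      exact rpow_le_one (by positivity) (by rw [div_le_one (by positivity)]; linarith)
        (by norm_num)
    · refine le_trans ?_ (hgrow A v le_rfl hvA)
      gcongr ?_ * ?_ ^ (2 : ℝ)
      · exact hle A hA.le
      · rw [div_le_div_iff₀ (by positivity) hA]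
        nlinarith
  set θ := γ + 1 + b - α with hθdef
  set C := (1 / (γ + 1)) ^ (1 / b) * (b / θ) with hC
  have hC0 : 0 < C := by positivity
  refine ⟨(1 / (H * C)) ^ (b / θ), by positivity, ?_⟩
  intro ρ U w h r hr hUr
  have h1 := h.rpow_le_of_growth hb hγ hθ (N := 2) (H := H) (σ := 1) one_lt_two hr
    (by linarith) (fun v hv => hH v (hUr.trans hv))
  have h2 : (U r + 1) ^ ((1 : ℝ) - 2) ≤ 1 :=
    rpow_le_one_of_one_le_of_nonpos (by linarith) (by norm_num)
  have h3 : r ^ (θ / b) ≤ 1 / (H * C) := by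
    rw [le_div_iff₀ (by positivity)]
    calc r ^ (θ / b) * (H * C) = (2 - 1) * H * C * r ^ (θ / b) := by ring
      _ ≤ 1 := h1.trans h2
  calc r = (r ^ (θ / b)) ^ (b / θ) := by
        rw [← rpow_mul hr.le, div_mul_div_comm, mul_comm b θ, div_self (by positivity), rpow_one]
    _ ≤ _ := rpow_le_rpow (by positivity) h3 (by positivity)

/-- For solutions of arbitrary height, `-r U' ≤ η U` as long as `U` stays above a fixed level. -/
theorem exists_forall_flux_le {α b γ η : ℝ} {f : ℝ → ℝ} (hb : 0 < b) (hγ : 0 < γ + 1)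
    (hθ : 0 < γ + 1 + b - α) (hη : 0 < η) (hηα : b * η < α - b) (hf : Differentiable ℝ f)
    (hB : Tendsto (fun u => u * deriv f u) atTop atTop) :
    ∃ A₀, 0 < A₀ ∧ ∀ ρ U w, IsRegularSolution α b γ ρ f U w → ∀ r, 0 < r → A₀ ≤ U r →
      w r ≤ η ^ b * (r ^ (α - b) * U r ^ b) := by
  set θ := γ + 1 + b - α with hθdef
  set C := (1 / (γ + 1)) ^ (1 / b) * (b / θ) with hC
  have hC0 : 0 < C := by positivity
  have hgap : 0 < α - b - b * η := by linarith
  set κ := η ^ b * (α - b - b * η) / 2 with hκ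
  have hκ0 : 0 < κ := by positivity
  set N := 1 + 1 / (C * κ ^ (1 / b)) with hN
  have hN1 : 1 < N := by
    have : 0 < 1 / (C * κ ^ (1 / b)) := by positivity
    linarith
  obtain ⟨A₀, hA, hgrow⟩ := exists_forall_exp_growth hb hf hB N
  refine ⟨A₀, hA, ?_⟩
  intro ρ U w h r hr hUr
  have hge : ∀ t, 0 < t → t ≤ r → A₀ ≤ U t := fun t h0 ht =>
    hUr.trans (h.strictAntiOn.antitoneOn h0.le hr.le ht)
  have hsource : ∀ t, 0 < t → t ≤ r → t ^ θ * exp (f (U t)) ≤ κ * U t ^ b := by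
    intro t ht htr
    have hAt := hge t ht htr
    have hUt : 0 < U t := hA.trans_le hAt
    have h1 := h.rpow_le_of_growth hb hγ hθ (N := N) (H := exp (f (U t) / b) / U t ^ N) (σ := 0)
      hN1 ht (by linarith) (by
        intro v hv
        have := hgrow (U t) v hAt hv
        rw [div_rpow (hUt.le.trans hv) hUt.le] at this
        rw [add_zero]
        calc _ = _ := by ring
          _ ≤ _ := this)
    rw [← hθdef, ← hC, add_zero] at h1
    have h2 : U t ^ (1 - N) = U t / U t ^ N := by rw [rpow_sub hUt, rpow_one]
    have h3 : (N - 1) * C = 1 / κ ^ (1 / b) := by rw [hN]; field_simp; ring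
    have hUN : 0 < U t ^ N := rpow_pos_of_pos hUt _
    have h4 : (N - 1) * (exp (f (U t) / b) / U t ^ N) * C * t ^ (θ / b) =
        ((N - 1) * C * (t ^ (θ / b) * exp (f (U t) / b))) / U t ^ N := by ring
    rw [h4, h2, div_le_div_iff_of_pos_right hUN, h3, one_div_mul_eq_div,
      div_le_iff₀ (by positivity)] at h1
    have h5 := rpow_le_rpow (by positivity) h1 hb.le
    rw [mul_rpow (by positivity) (by positivity), mul_rpow hUt.le (by positivity), ← exp_mul,
      ← rpow_mul ht.le, ← rpow_mul hκ0.le, div_mul_cancel₀ _ hb.ne', div_mul_cancel₀ _ hb.ne',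
      div_mul_cancel₀ _ hb.ne', rpow_one] at h5
    linarith
  set D := exp (f ρ) / (γ + 1) with hD
  have hD0 : 0 < D := by positivity
  obtain ⟨s, hs0, hsr, hs⟩ : ∃ s, 0 < s ∧ s ≤ r ∧ D * s ^ θ ≤ η ^ b * A₀ ^ b := by
    refine ⟨min r ((η ^ b * A₀ ^ b / D) ^ (1 / θ)), by positivity, min_le_left _ _, ?_⟩
    have h1 : (min r ((η ^ b * A₀ ^ b / D) ^ (1 / θ))) ^ θ ≤ η ^ b * A₀ ^ b / D := by
      calc _ ≤ ((η ^ b * A₀ ^ b / D) ^ (1 / θ)) ^ θ :=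
            rpow_le_rpow (by positivity) (min_le_right _ _) hθ.le
        _ = _ := by rw [← rpow_mul (by positivity), div_mul_cancel₀ _ hθ.ne', rpow_one]
    rw [le_div_iff₀ hD0] at h1
    linarith
  have hstart : w s ≤ η ^ b * (s ^ (α - b) * U s ^ b) := by
    have h1 := h.flux_le s hs0
    have h2 : s ^ (γ + 1) = s ^ θ * s ^ (α - b) := by
      rw [← rpow_add hs0, hθdef]; congr 1; ring
    have h3 : A₀ ^ b ≤ U s ^ b := rpow_le_rpow hA.le (hge s hs0 hsr) hb.le
    calc w s ≤ exp (f ρ) * (s ^ (γ + 1) / (γ + 1)) := h1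
      _ = D * s ^ θ * s ^ (α - b) := by rw [h2, hD]; ring
      _ ≤ η ^ b * A₀ ^ b * s ^ (α - b) := by gcongr
      _ ≤ η ^ b * U s ^ b * s ^ (α - b) := by gcongr
      _ = _ := by ring
  have hd : ∀ t, 0 < t → t ≤ r → HasDerivAt (fun t => η ^ b * (t ^ (α - b) * U t ^ b))
      (η ^ b * (((α - b) * t ^ (α - b - 1)) * U t ^ b +
        t ^ (α - b) * (-(t ^ (-(α / b)) * w t ^ (1 / b)) * b * U t ^ (b - 1)))) t := by
    intro t ht htr
    exact (((hasDerivAt_rpow_const (Or.inl ht.ne')).mul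
      ((h.hasDerivAt t ht).rpow_const (Or.inl (hA.trans_le (hge t ht htr)).ne')))).const_mul _
  refine image_le_of_deriv_right_lt_deriv_boundary' (a := s) (b := r) (f := w)
    (f' := fun t => t ^ γ * exp (f (U t)))
    (B := fun t => η ^ b * (t ^ (α - b) * U t ^ b))
    (fun t ht => (h.hasDerivAt_flux t (hs0.trans_le ht.1)).continuousAt.continuousWithinAt)
    (fun t ht => (h.hasDerivAt_flux t (hs0.trans_le ht.1)).hasDerivWithinAt) hstart
    (fun t ht => (hd t (hs0.trans_le ht.1) ht.2).continuousAt.continuousWithinAt)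
    (fun t ht => (hd t (hs0.trans_le ht.1) ht.2.le).hasDerivWithinAt) ?_ ⟨hsr, le_rfl⟩
  intro t ht hwt
  have ht0 : 0 < t := hs0.trans_le ht.1
  have hUt : 0 < U t := hA.trans_le (hge t ht0 ht.2.le)
  have hUb : U t ^ (b - 1) = U t ^ b / U t := by rw [rpow_sub hUt, rpow_one]
  have htb : t ^ (α - b - 1) = t ^ (α - b) / t := by rw [rpow_sub ht0, rpow_one]
  have hw1 : t ^ (-(α / b)) * w t ^ (1 / b) = η * U t / t := by
    rw [hwt, mul_rpow (by positivity) (by positivity), mul_rpow (by positivity) (by positivity),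
      ← rpow_mul hη.le, ← rpow_mul hUt.le, ← rpow_mul ht0.le, mul_one_div, mul_one_div,
      div_self hb.ne', rpow_one, rpow_one, sub_div, div_self hb.ne', rpow_sub ht0, rpow_one,
      rpow_neg ht0.le]
    have := rpow_pos_of_pos ht0 (α / b)
    field_simp
  have hγt : t ^ γ = t ^ θ * (t ^ (α - b) / t) := by
    rw [← htb, ← rpow_add ht0, hθdef]; congr 1; ring
  rw [hw1, hUb, htb]
  have h6 : η ^ b * ((α - b) * (t ^ (α - b) / t) * U t ^ b +
      t ^ (α - b) * (-(η * U t / t) * b * (U t ^ b / U t))) =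
      (t ^ (α - b) / t) * (2 * κ * U t ^ b) := by
    rw [hκ]; field_simp; ring
  rw [h6, hγt]
  have h7 := hsource t ht0 ht.2.le
  have h8 : 0 < t ^ (α - b) / t := by positivity
  have h9 : 0 < κ * U t ^ b := by positivity
  calc t ^ θ * (t ^ (α - b) / t) * exp (f (U t))
      = t ^ (α - b) / t * (t ^ θ * exp (f (U t))) := by ring
    _ < _ := mul_lt_mul_of_pos_left (by linarith) h8

theorem add_rpow_le_two_rpow_mul {x y p : ℝ} (hx : 0 ≤ x) (hy : 0 ≤ y) (hp : 0 ≤ p) :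
    (x + y) ^ p ≤ 2 ^ p * (x ^ p + y ^ p) := by
  have hx' := rpow_nonneg hx p
  have hy' := rpow_nonneg hy p
  have h2 : (0 : ℝ) ≤ 2 ^ p := by positivity
  rcases le_total x y with hxy | hxy
  · calc (x + y) ^ p ≤ (2 * y) ^ p := rpow_le_rpow (by positivity) (by linarith) hp
      _ = 2 ^ p * y ^ p := mul_rpow (by norm_num) hy
      _ ≤ _ := by gcongr; linarith
  · calc (x + y) ^ p ≤ (2 * x) ^ p := rpow_le_rpow (by positivity) (by linarith) hp
      _ = 2 ^ p * x ^ p := mul_rpow (by norm_num) hx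
      _ ≤ _ := by gcongr; linarith

/-- After radius `s` the decrease of `U` is controlled by the flux through `s` and by the source
at height `U s`. -/
theorem IsRegularSolution.sub_le {α b γ ρ : ℝ} {f U w : ℝ → ℝ}
    (h : IsRegularSolution α b γ ρ f U w) (hb : 0 < b) (hγ : 0 < γ + 1) (hαb : b < α)
    (hθ : 0 < γ + 1 + b - α) {s r : ℝ} (hs : 0 < s) (hsr : s ≤ r) :
    U s - U r ≤ 2 ^ (1 / b) * (w s ^ (1 / b) * s ^ (1 - α / b) / (α / b - 1) +
      (exp (f (U s)) / (γ + 1)) ^ (1 / b) * (b / (γ + 1 + b - α)) *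
        r ^ ((γ + 1 + b - α) / b)) := by
  set θ := γ + 1 + b - α with hθdef
  set m := w s ^ (1 / b) with hm
  set E := (exp (f (U s)) / (γ + 1)) ^ (1 / b) with hE
  have hm0 : 0 < m := rpow_pos_of_pos (h.flux_pos s hs) _
  have hE0 : 0 < E := by positivity
  have hα1 : 0 < α / b - 1 := by
    rw [sub_pos, one_lt_div hb]; exact hαb
  have hmono : MonotoneOn (fun t => U t + 2 ^ (1 / b) *
      (E * (b / θ) * t ^ (θ / b) - m / (α / b - 1) * t ^ (1 - α / b))) (Icc s r) := by
    have hd : ∀ t ∈ Icc s r, HasDerivAt (fun t => U t + 2 ^ (1 / b) *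
        (E * (b / θ) * t ^ (θ / b) - m / (α / b - 1) * t ^ (1 - α / b)))
        (-(t ^ (-(α / b)) * w t ^ (1 / b)) + 2 ^ (1 / b) *
          (E * (b / θ) * ((θ / b) * t ^ (θ / b - 1)) -
            m / (α / b - 1) * ((1 - α / b) * t ^ (1 - α / b - 1)))) t := by
      intro t ht
      have ht0 : t ≠ 0 := (hs.trans_le ht.1).ne'
      exact (h.hasDerivAt t (hs.trans_le ht.1)).add
        ((((hasDerivAt_rpow_const (Or.inl ht0)).const_mul _).sub
          ((hasDerivAt_rpow_const (Or.inl ht0)).const_mul _)).const_mul _)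
    apply monotoneOn_of_deriv_nonneg (convex_Icc _ _)
    · exact fun t ht => (hd t ht).continuousAt.continuousWithinAt
    · exact fun t ht => (hd t (interior_subset ht)).differentiableAt.differentiableWithinAt
    · intro t ht
      have ht' := interior_subset ht
      have ht0 := hs.trans_le ht'.1
      rw [(hd t ht').deriv]
      have h1 : E * (b / θ) * ((θ / b) * t ^ (θ / b - 1)) = E * t ^ (θ / b - 1) := by
        field_simp
      have h2 : m / (α / b - 1) * ((1 - α / b) * t ^ (1 - α / b - 1)) = -(m * t ^ (-(α / b))) := by
        rw [show 1 - α / b - 1 = -(α / b) by ring, show 1 - α / b = -(α / b - 1) by ring]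
        generalize α / b - 1 = q at hα1
        field_simp
      have h3 := h.flux_le_add s t hs ht'.1
      have h4 := rpow_neg_mul_rpow_source (α := α) hb hγ ht0 (exp_pos (f (U s))).le
      have ht1 : 0 < t ^ (γ + 1) := rpow_pos_of_pos ht0 _
      have h5 : w t ^ (1 / b) ≤ 2 ^ (1 / b) *
          (m + (exp (f (U s)) * (t ^ (γ + 1) / (γ + 1))) ^ (1 / b)) :=
        (rpow_le_rpow (h.flux_pos t ht0).le h3 (by positivity)).trans
          (add_rpow_le_two_rpow_mul (h.flux_pos s hs).le (by positivity) (by positivity))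
      have h6 := mul_le_mul_of_nonneg_left h5 (rpow_nonneg ht0.le (-(α / b)))
      rw [h1, h2, ← h4]
      linarith
  have h7 := hmono ⟨le_rfl, hsr⟩ ⟨hsr, le_rfl⟩ hsr
  simp only at h7
  have hr := hs.trans_le hsr
  have h8 : 0 ≤ E * (b / θ) * s ^ (θ / b) := by positivity
  have h9 : 0 ≤ m / (α / b - 1) * r ^ (1 - α / b) := by positivity
  have h10 : (0 : ℝ) < 2 ^ (1 / b) := by positivity
  have h11 := mul_nonneg h10.le h8
  have h12 := mul_nonneg h10.le h9
  have h13 : m * s ^ (1 - α / b) / (α / b - 1) = m / (α / b - 1) * s ^ (1 - α / b) := by ring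
  rw [h13]
  linarith

theorem IsRegularSolution.exists_eq {α b γ ρ R B : ℝ} {f U w : ℝ → ℝ}
    (h : IsRegularSolution α b γ ρ f U w) (hR0 : 0 < R)
    (hR : ∀ r, 0 < r → 0 ≤ U r → r ≤ R) (hB : 0 ≤ B) (hBρ : B < ρ) :
    ∃ r, 0 < r ∧ U r = B := by
  have h1 : U (R + 1) < 0 := by
    by_contra! hneg
    linarith [hR (R + 1) (by linarith) hneg]
  obtain ⟨r, hr, hUr⟩ := intermediate_value_Icc' (by linarith : (0 : ℝ) ≤ R + 1)
    (h.continuousOn.mono Icc_subset_Ici_self)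
    (show B ∈ Icc (U (R + 1)) (U 0) from ⟨by linarith, by rw [h.map_zero]; exact hBρ.le⟩)
  refine ⟨r, lt_of_le_of_ne hr.1 ?_, hUr⟩
  rintro rfl
  rw [h.map_zero] at hUr
  exact hBρ.ne' hUr

theorem exists_radius_lower_bound {α b γ B : ℝ} {f : ℝ → ℝ} (hb : 0 < b) (hγ : 0 < γ + 1)
    (hαb : b < α) (hθ : 0 < γ + 1 + b - α) (hf : Differentiable ℝ f)
    (hmono : StrictMono f) (hB : Tendsto (fun u => u * deriv f u) atTop atTop) :
    ∃ R ρ₀, 0 < R ∧ B < ρ₀ ∧ ∀ ρ U w, IsRegularSolution α b γ ρ f U w → ρ₀ ≤ ρ →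
      ∀ r, 0 < r → U r = B → R ≤ r := by
  set p : ℝ := 2 ^ (1 / b) with hp
  have hp0 : 0 < p := by positivity
  have hα0 : 0 < α - b := by linarith
  have hα1 : 0 < α / b - 1 := by
    rw [sub_pos, one_lt_div hb]; exact hαb
  set η := min ((α - b) / (2 * b)) ((α / b - 1) / (4 * p)) with hη
  have hη0 : 0 < η := by positivity
  have hη1 : b * η < α - b := by
    have h1 : η ≤ (α - b) / (2 * b) := min_le_left _ _
    rw [le_div_iff₀ (by positivity)] at h1
    linarith
  have hη2 : p * (η / (α / b - 1)) ≤ 1 / 4 := by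
    have h1 : η ≤ (α / b - 1) / (4 * p) := min_le_right _ _
    rw [le_div_iff₀ (by positivity)] at h1
    rw [← mul_div_assoc, div_le_iff₀ hα1]
    linarith
  obtain ⟨A₀, hA₀, hflux⟩ := exists_forall_flux_le hb hγ hθ hη0 hη1 hf hB
  obtain ⟨R₁, hR₁, hrad⟩ := exists_radius_bound hb hγ hθ hf hmono hB
  set θ := γ + 1 + b - α with hθdef
  set A := max A₀ (2 * B) with hA
  have hA0 : 0 < A := hA₀.trans_le (le_max_left _ _)
  have hAB : 2 * B ≤ A := le_max_right _ _
  set D := p * ((exp (f A) / (γ + 1)) ^ (1 / b) * (b / θ)) with hD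
  have hD0 : 0 < D := by positivity
  refine ⟨(A / 4 / D) ^ (b / θ), A + 1, by positivity, by linarith, ?_⟩
  intro ρ U w h hρ r hr hUr
  obtain ⟨s, hs, hUs⟩ := h.exists_eq hR₁ (hrad ρ U w h) hA0.le (by linarith : A < ρ)
  have hsr : s ≤ r := by
    by_contra! hlt
    have := h.strictAntiOn hr.le hs.le hlt
    rw [hUs, hUr] at this
    linarith
  have h1 := h.sub_le hb hγ hαb hθ hs hsr
  rw [hUs, hUr] at h1
  have h2 := hflux ρ U w h s hs (by rw [hUs]; exact le_max_left _ _)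
  rw [hUs] at h2
  have h3 : w s ^ (1 / b) * s ^ (1 - α / b) ≤ η * A := by
    have h4 := rpow_le_rpow (h.flux_pos s hs).le h2 (by positivity : 0 ≤ 1 / b)
    rw [mul_rpow (by positivity) (by positivity), mul_rpow (by positivity) (by positivity),
      ← rpow_mul hη0.le, ← rpow_mul hA0.le, ← rpow_mul hs.le, mul_one_div, mul_one_div,
      div_self hb.ne', rpow_one, rpow_one, sub_div, div_self hb.ne'] at h4
    calc w s ^ (1 / b) * s ^ (1 - α / b)
        ≤ η * (s ^ (α / b - 1) * A) * s ^ (1 - α / b) := by gcongr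
      _ = η * A * (s ^ (α / b - 1) * s ^ (1 - α / b)) := by ring
      _ = η * A := by rw [← rpow_add hs]; simp
  have h5 : p * (w s ^ (1 / b) * s ^ (1 - α / b) / (α / b - 1)) ≤ A / 4 := by
    calc p * (w s ^ (1 / b) * s ^ (1 - α / b) / (α / b - 1))
        ≤ p * (η * A / (α / b - 1)) := by gcongr
      _ = p * (η / (α / b - 1)) * A := by ring
      _ ≤ 1 / 4 * A := by gcongr
      _ = A / 4 := by ring
  have h6 : A / 4 / D ≤ r ^ (θ / b) := by
    rw [div_le_iff₀ hD0, hD]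
    rw [mul_add] at h1
    linarith
  calc (A / 4 / D) ^ (b / θ) ≤ (r ^ (θ / b)) ^ (b / θ) :=
        rpow_le_rpow (by positivity) h6 (by positivity)
    _ = r := by
      rw [← rpow_mul hr.le, div_mul_div_comm, mul_comm b θ, div_self (by positivity), rpow_one]

/-- Proposition 3.1: under (B1)–(B3), for the regular solutions `u(·,ρ)` of
`L(u) + e^{f(u)} = 0` (given by the integral equation), for every `B ≥ 0` and every
`ρ > B` there is a unique `R(B,ρ) > 0` with `u(R(B,ρ),ρ) = B`, and there exist
positive bounds `R̲(B) ≤ R(B,ρ) ≤ R̄(B)` valid for all `ρ ≥ ρ₀(B)`, the upper bound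
being valid for all `ρ ≥ B`. -/
theorem stmt_15 (α β γ θ : ℝ) (hθ : θ = γ + 2 + β - α) (f : ℝ → ℝ)
    -- (B1)
    (hf : ContDiff ℝ 1 f) (hf' : ∀ u : ℝ, 0 < deriv f u)
    (hftop : Tendsto f atTop atTop)
    -- (B2)
    (hB2a : Tendsto (fun u : ℝ => Real.exp (f u / (β + 1)) / u) atTop atTop)
    (hB2b : Tendsto (fun u : ℝ => u * deriv f u) atTop atTop)
    -- (B3)
    (hαβ : α > β + 1) (hβ : 0 < β + 1) (hθpos : 0 < θ)
    -- the family of regular solutions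
    (u : ℝ → ℝ → ℝ)
    (hucont : ∀ ρ : ℝ, ContinuousOn (u ρ) (Ici 0))
    (hueq : ∀ ρ : ℝ, ∀ r, 0 ≤ r →
      u ρ r = ρ - ∫ t in (0:ℝ)..r, t ^ (-(α / (β + 1))) *
        (∫ s in (0:ℝ)..t, s ^ γ * Real.exp (f (u ρ s))) ^ ((1:ℝ) / (β + 1))) :
    -- (i) existence and uniqueness of R(B,ρ)
    (∀ B, 0 ≤ B → ∀ ρ, B < ρ → ∃! r : ℝ, 0 < r ∧ u ρ r = B) ∧
    -- (ii) the bounds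
    (∀ B, 0 ≤ B → ∃ Rlo Rhi ρ₀ : ℝ, 0 < Rlo ∧ 0 < Rhi ∧ B < ρ₀ ∧
      (∀ ρ, ρ₀ ≤ ρ → ∀ r, 0 < r → u ρ r = B → Rlo ≤ r ∧ r ≤ Rhi) ∧
      (∀ ρ, B ≤ ρ → ∀ r, 0 < r → u ρ r = B → r ≤ Rhi)) := by
  have hstrict : StrictMono f := strictMono_of_deriv_pos hf'
  have hdiff : Differentiable ℝ f := hf.differentiable one_ne_zero
  have hθ' : 0 < γ + 1 + (β + 1) - α := by linarith
  have hγ : 0 < γ + 1 := by linarith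
  have hsol := fun ρ => IsRegularSolution.of_integral_eq hf.continuous hstrict hαβ hβ hθ'
    (hucont ρ) (hueq ρ)
  obtain ⟨Rhi, hRhi, hhi⟩ := exists_radius_bound hβ hγ hθ' hdiff hstrict hB2b
  refine ⟨fun B hB ρ hρ => ?_, fun B hB => ?_⟩
  · obtain ⟨r, hr, hur⟩ := (hsol ρ).exists_eq hRhi (hhi ρ _ _ (hsol ρ)) hB hρ
    exact ⟨r, ⟨hr, hur⟩, fun s hs =>
      (hsol ρ).strictAntiOn.injOn hs.1.le hr.le (hs.2.trans hur.symm)⟩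
  · obtain ⟨Rlo, ρ₀, hRlo, hρ₀, hlo⟩ :=
      exists_radius_lower_bound hβ hγ hαβ hθ' hdiff hstrict hB2b
    have hup : ∀ ρ r, 0 < r → u ρ r = B → r ≤ Rhi := fun ρ r hr hur =>
      hhi ρ _ _ (hsol ρ) r hr (by rw [hur]; exact hB)
    exact ⟨Rlo, Rhi, ρ₀, hRlo, hRhi, hρ₀,
      fun ρ hρ r hr hur => ⟨hlo ρ _ _ (hsol ρ) hρ r hr hur, hup ρ r hr hur⟩,
      fun ρ _ r hr hur => hup ρ r hr hur⟩
end

section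
/- Assume (B1)–(B3) and for ρ ≥ 0 let u(·,ρ) be the unique continuous solution of u(r) = ρ − ∫₀^r t^{−α/(β+1)} ( ∫₀^t s^γ e^{f(u(s))} ds )^{1/(β+1)} dt. Then: (i) for every interval [r₁,r₂] ⊂ (0,∞), the family of restrictions { u(·,ρ)|_{[r₁,r₂]} : ρ ≥ 0 } is relatively compact in C([r₁,r₂]) with the supremum norm; (ii) if u** : (0,∞) → ℝ is the limit of a sequence u(·,ρ_n), uniformly on every compact subset of (0,∞), then u** is differentiable, strictly decreasing, and satisfies (r^α |(u**)'(r)|^β (u**)'(r))' = − r^γ e^{f(u**(r))} on (0,∞); moreover if ρ_n → +∞ then u**(r) → +∞ as r → 0+ (u** is a singular solution), while if ρ_n → ρ̄ < +∞ then u** = u(·,ρ̄) (a regular solution). -/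
open Filter Set Real

theorem le_of_hasDerivAt_nonneg {h h' : ℝ → ℝ} {a b : ℝ} (hab : a ≤ b)
    (hc : ContinuousOn h (Icc a b)) (hd : ∀ x ∈ Ioo a b, HasDerivAt h (h' x) x)
    (h0 : ∀ x ∈ Ioo a b, 0 ≤ h' x) : h a ≤ h b := by
  refine monotoneOn_of_deriv_nonneg (convex_Icc a b) hc ?_ ?_
    (left_mem_Icc.2 hab) (right_mem_Icc.2 hab) hab
  · rw [interior_Icc]
    exact fun x hx => (hd x hx).differentiableAt.differentiableWithinAt
  · rw [interior_Icc]
    exact fun x hx => by rw [(hd x hx).deriv]; exact h0 x hx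

/-- A differentiable function whose derivative is continuous on a compact interval is Lipschitz
there. -/
theorem exists_lipschitz_bound_Icc {g : ℝ → ℝ} {a b : ℝ}
    (hd : ∀ x ∈ Icc a b, DifferentiableAt ℝ g x) (hc : ContinuousOn (deriv g) (Icc a b)) :
    ∃ L : ℝ, 0 ≤ L ∧ ∀ x ∈ Icc a b, ∀ y ∈ Icc a b, |g x - g y| ≤ L * |x - y| := by
  obtain ⟨L, hL⟩ := isCompact_Icc.exists_bound_of_continuousOn hc
  refine ⟨max L 0, le_max_right _ _, fun x hx y hy => ?_⟩
  exact Convex.norm_image_sub_le_of_norm_deriv_le hd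
    (fun z hz => (hL z hz).trans (le_max_left _ _)) (convex_Icc a b) hy hx

/-- The weighted mass `∫₀ᵗ s^γ e^{f(y(s))} ds`. -/
noncomputable def mass (γ : ℝ) (f y : ℝ → ℝ) (t : ℝ) : ℝ :=
  ∫ s in (0 : ℝ)..t, s ^ γ * Real.exp (f (y s))

/-- The speed of descent `-y'(t)` of a regular solution. -/
noncomputable def speed (α p γ : ℝ) (f y : ℝ → ℝ) (t : ℝ) : ℝ :=
  t ^ (-(α / p)) * mass γ f y t ^ ((1 : ℝ) / p)

/-- The structural assumptions on the exponents and the nonlinearity, with `p = β + 1`. -/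
structure Admissible (α p γ : ℝ) (f : ℝ → ℝ) : Prop where
  p_pos : 0 < p
  p_lt : p < α
  lt_gamma : α - p < γ + 1
  contDiff : ContDiff ℝ 1 f
  strictMono : StrictMono f
  exp_growth : Tendsto (fun u : ℝ => Real.exp (f u / p) / u) atTop atTop
  deriv_growth : Tendsto (fun u : ℝ => u * deriv f u) atTop atTop

/-- Continuous solutions of the integral equation with initial value `ρ`. -/
structure IsRegularSolution_s16 (α p γ : ℝ) (f : ℝ → ℝ) (ρ : ℝ) (y : ℝ → ℝ) : Prop where
  continuousOn : ContinuousOn y (Ici 0)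
  eq : ∀ r, 0 ≤ r → y r = ρ - ∫ t in (0 : ℝ)..r, speed α p γ f y t

/-- The scaling exponent `θ / p`. -/
noncomputable def scalingExponent (α p γ : ℝ) : ℝ := (γ + 1 - α) / p + 1

namespace Admissible

variable {α p γ : ℝ} {f : ℝ → ℝ}

theorem gamma_pos (h : Admissible α p γ f) : 0 < γ + 1 := by
  linarith [h.lt_gamma, h.p_lt]

theorem scalingExponent_pos (h : Admissible α p γ f) : 0 < scalingExponent α p γ := by
  have hp := h.p_pos
  have : scalingExponent α p γ = (γ + 1 - (α - p)) / p := by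
    unfold scalingExponent; field_simp; ring
  rw [this]
  exact div_pos (by linarith [h.lt_gamma]) hp

theorem decay_pos (h : Admissible α p γ f) : 0 < α / p - 1 := by
  have hp := h.p_pos
  rw [sub_pos, one_lt_div hp]; exact h.p_lt

theorem continuous (h : Admissible α p γ f) : Continuous f := h.contDiff.continuous

theorem hasDerivAt (h : Admissible α p γ f) (x : ℝ) : HasDerivAt f (deriv f x) x :=
  (h.contDiff.differentiable (by simp) x).hasDerivAt

theorem rpow_mul_rpow (h : Admissible α p γ f) {t c : ℝ} (ht : 0 < t) (hc : 0 ≤ c) :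
    t ^ (-(α / p)) * (c * t ^ (γ + 1)) ^ (1 / p) =
      c ^ (1 / p) * t ^ (scalingExponent α p γ - 1) := by
  rw [mul_rpow hc (rpow_nonneg ht.le _), ← rpow_mul ht.le, mul_left_comm, ← rpow_add ht]
  congr 2
  have := h.p_pos.ne'
  unfold scalingExponent
  field_simp
  ring

end Admissible

namespace IsRegularSolution_s16

variable {α p γ ρ : ℝ} {f y : ℝ → ℝ}

theorem continuousOn_exp (hA : Admissible α p γ f) (h : IsRegularSolution_s16 α p γ f ρ y) :
    ContinuousOn (fun s => Real.exp (f (y s))) (Ici 0) :=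
  (Real.continuous_exp.comp hA.continuous).comp_continuousOn h.continuousOn

theorem integrable_density (hA : Admissible α p γ f) (h : IsRegularSolution_s16 α p γ f ρ y)
    {a b : ℝ} (ha : 0 ≤ a) (hb : 0 ≤ b) :
    IntervalIntegrable (fun s => s ^ γ * Real.exp (f (y s))) MeasureTheory.volume a b := by
  refine (intervalIntegral.intervalIntegrable_rpow' (by linarith [hA.gamma_pos])).mul_continuousOn
    ((h.continuousOn_exp hA).mono fun x hx => ?_)
  exact (le_min ha hb).trans hx.1

theorem hasDerivAt_mass (hA : Admissible α p γ f) (h : IsRegularSolution_s16 α p γ f ρ y)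
    {t : ℝ} (ht : 0 < t) :
    HasDerivAt (mass γ f y) (t ^ γ * Real.exp (f (y t))) t := by
  have hc : ContinuousOn (fun s => s ^ γ * Real.exp (f (y s))) (Ioi 0) :=
    (continuousOn_id.rpow_const fun _ hx => Or.inl (ne_of_gt hx)).mul
      ((h.continuousOn_exp hA).mono Ioi_subset_Ici_self)
  exact intervalIntegral.integral_hasDerivAt_right (h.integrable_density hA le_rfl ht.le)
    (hc.stronglyMeasurableAtFilter isOpen_Ioi t ht) (hc.continuousAt (Ioi_mem_nhds ht))

theorem continuousOn_mass (hA : Admissible α p γ f) (h : IsRegularSolution_s16 α p γ f ρ y) (T : ℝ) :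
    ContinuousOn (mass γ f y) (Icc 0 T) := by
  rcases le_or_gt 0 T with hT | hT
  · have := intervalIntegral.continuousOn_primitive_interval'
      (h.integrable_density hA le_rfl hT) left_mem_uIcc
    rwa [uIcc_of_le hT] at this
  · rw [Icc_eq_empty (not_le.2 hT)]; exact continuousOn_empty _

theorem mass_pos (hA : Admissible α p γ f) (h : IsRegularSolution_s16 α p γ f ρ y)
    {t : ℝ} (ht : 0 < t) : 0 < mass γ f y t :=
  intervalIntegral.intervalIntegral_pos_of_pos_on (h.integrable_density hA le_rfl ht.le)
    (fun _ hx => mul_pos (rpow_pos_of_pos hx.1 _) (Real.exp_pos _)) ht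

theorem mass_sub (hA : Admissible α p γ f) (h : IsRegularSolution_s16 α p γ f ρ y)
    {a b : ℝ} (ha : 0 ≤ a) (hb : 0 ≤ b) :
    mass γ f y b = mass γ f y a + ∫ s in a..b, s ^ γ * Real.exp (f (y s)) :=
  (intervalIntegral.integral_add_adjacent_intervals (h.integrable_density hA le_rfl ha)
    (h.integrable_density hA ha hb)).symm

theorem mass_mono (hA : Admissible α p γ f) (h : IsRegularSolution_s16 α p γ f ρ y)
    {a b : ℝ} (ha : 0 ≤ a) (hab : a ≤ b) : mass γ f y a ≤ mass γ f y b := by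
  rw [h.mass_sub hA ha (ha.trans hab)]
  have : 0 ≤ ∫ s in a..b, s ^ γ * Real.exp (f (y s)) :=
    intervalIntegral.integral_nonneg hab fun x hx =>
      mul_nonneg (rpow_nonneg (ha.trans hx.1) _) (Real.exp_pos _).le
  linarith

theorem mass_nonneg (hA : Admissible α p γ f) (h : IsRegularSolution_s16 α p γ f ρ y)
    {t : ℝ} (ht : 0 ≤ t) : 0 ≤ mass γ f y t := by
  have := h.mass_mono hA le_rfl ht
  simpa [mass] using this

theorem integral_le (hA : Admissible α p γ f) (h : IsRegularSolution_s16 α p γ f ρ y)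
    {a b m : ℝ} (ha : 0 ≤ a) (hab : a ≤ b) (hm : ∀ s ∈ Icc a b, y s ≤ m) :
    ∫ s in a..b, s ^ γ * Real.exp (f (y s)) ≤ Real.exp (f m) / (γ + 1) * b ^ (γ + 1) := by
  have hγ := hA.gamma_pos
  have h1 : ∫ s in a..b, s ^ γ * Real.exp (f (y s)) ≤ ∫ s in a..b, s ^ γ * Real.exp (f m) := by
    refine intervalIntegral.integral_mono_on hab (h.integrable_density hA ha (ha.trans hab))
      ((intervalIntegral.intervalIntegrable_rpow' (by linarith)).mul_const _) fun x hx => ?_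
    exact mul_le_mul_of_nonneg_left (Real.exp_le_exp.2 (hA.strictMono.monotone (hm x hx)))
      (rpow_nonneg (ha.trans hx.1) _)
  refine h1.trans ?_
  rw [intervalIntegral.integral_mul_const, integral_rpow (Or.inl (by linarith)),
    div_mul_eq_mul_div, div_mul_eq_mul_div]
  refine div_le_div_of_nonneg_right ?_ hγ.le
  rw [mul_comm]
  exact mul_le_mul_of_nonneg_left (by linarith [rpow_nonneg ha (γ + 1)]) (Real.exp_pos _).le

theorem mass_le_of_le (hA : Admissible α p γ f) (h : IsRegularSolution_s16 α p γ f ρ y)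
    {t m : ℝ} (ht : 0 ≤ t) (hm : ∀ s ∈ Icc 0 t, y s ≤ m) :
    mass γ f y t ≤ Real.exp (f m) / (γ + 1) * t ^ (γ + 1) :=
  h.integral_le hA le_rfl ht hm

theorem le_mass_of_le (hA : Admissible α p γ f) (h : IsRegularSolution_s16 α p γ f ρ y)
    {t m : ℝ} (ht : 0 ≤ t) (hm : ∀ s ∈ Icc 0 t, m ≤ y s) :
    Real.exp (f m) / (γ + 1) * t ^ (γ + 1) ≤ mass γ f y t := by
  have hγ := hA.gamma_pos
  have h1 : ∫ s in 0..t, s ^ γ * Real.exp (f m) ≤ mass γ f y t := by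
    refine intervalIntegral.integral_mono_on ht
      ((intervalIntegral.intervalIntegrable_rpow' (by linarith)).mul_const _)
      (h.integrable_density hA le_rfl ht) fun x hx => ?_
    exact mul_le_mul_of_nonneg_left (Real.exp_le_exp.2 (hA.strictMono.monotone (hm x hx)))
      (rpow_nonneg hx.1 _)
  refine le_trans (le_of_eq ?_) h1
  rw [intervalIntegral.integral_mul_const, integral_rpow (Or.inl (by linarith)),
    zero_rpow hγ.ne', sub_zero]
  ring

theorem speed_le (hA : Admissible α p γ f) {t C : ℝ} (h0 : 0 ≤ mass γ f y t) (ht : 0 < t)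
    (hC : 0 ≤ C) (hm : mass γ f y t ≤ C * t ^ (γ + 1)) :
    speed α p γ f y t ≤ C ^ (1 / p) * t ^ (scalingExponent α p γ - 1) := by
  rw [← hA.rpow_mul_rpow ht hC]
  exact mul_le_mul_of_nonneg_left
    (rpow_le_rpow h0 hm (one_div_nonneg.2 hA.p_pos.le)) (rpow_nonneg ht.le _)

theorem speed_pos (hA : Admissible α p γ f) (h : IsRegularSolution_s16 α p γ f ρ y)
    {t : ℝ} (ht : 0 < t) : 0 < speed α p γ f y t :=
  mul_pos (rpow_pos_of_pos ht _) (rpow_pos_of_pos (h.mass_pos hA ht) _)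

theorem hasDerivAt_speed (hA : Admissible α p γ f) (h : IsRegularSolution_s16 α p γ f ρ y)
    {t : ℝ} (ht : 0 < t) :
    HasDerivAt (speed α p γ f y) (speed α p γ f y t *
      (-(α / p) / t + 1 / p * (t ^ γ * Real.exp (f (y t))) / mass γ f y t)) t := by
  have hw := h.mass_pos hA ht
  have h1 := (Real.hasDerivAt_rpow_const (x := t) (p := -(α / p)) (Or.inl ht.ne')).mul
    ((h.hasDerivAt_mass hA ht).rpow_const (p := 1 / p) (Or.inl hw.ne'))
  refine h1.congr_deriv ?_
  rw [rpow_sub_one ht.ne', rpow_sub_one hw.ne', speed]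
  ring

theorem continuousOn_speed (hA : Admissible α p γ f) (h : IsRegularSolution_s16 α p γ f ρ y) :
    ContinuousOn (speed α p γ f y) (Ioi 0) :=
  fun _ ht => (h.hasDerivAt_speed hA ht).continuousAt.continuousWithinAt

theorem integrable_speed (hA : Admissible α p γ f) (h : IsRegularSolution_s16 α p γ f ρ y)
    {T : ℝ} (hT : 0 ≤ T) :
    IntervalIntegrable (speed α p γ f y) MeasureTheory.volume 0 T := by
  obtain ⟨m, hm⟩ := isCompact_Icc.bddAbove_image 
    (h.continuousOn.mono (Icc_subset_Ici_self : Icc 0 T ⊆ Ici 0))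
  have hγ := hA.gamma_pos
  have hC : 0 ≤ Real.exp (f m) / (γ + 1) := by positivity
  refine ((intervalIntegral.intervalIntegrable_rpow' (a := 0) (b := T)
    (r := scalingExponent α p γ - 1) (by linarith [hA.scalingExponent_pos])).const_mul
      ((Real.exp (f m) / (γ + 1)) ^ (1 / p))).mono_fun' ?_ ?_
  · rw [uIoc_of_le hT]
    exact ((h.continuousOn_speed hA).mono fun x hx => hx.1).aestronglyMeasurable measurableSet_Ioc
  · rw [uIoc_of_le hT]
    refine (MeasureTheory.ae_restrict_iff' measurableSet_Ioc).2 (Eventually.of_forall fun t ht => ?_)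
    beta_reduce
    rw [Real.norm_of_nonneg (h.speed_pos hA ht.1).le]
    refine speed_le hA (h.mass_nonneg hA ht.1.le) ht.1 hC (h.mass_le_of_le hA ht.1.le fun s hs => ?_)
    exact hm (mem_image_of_mem y ⟨hs.1, hs.2.trans ht.2⟩)

theorem hasDerivAt (hA : Admissible α p γ f) (h : IsRegularSolution_s16 α p γ f ρ y)
    {t : ℝ} (ht : 0 < t) : HasDerivAt y (-speed α p γ f y t) t := by
  have hc := h.continuousOn_speed hA
  have h1 := (intervalIntegral.integral_hasDerivAt_right (h.integrable_speed hA ht.le)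
    (hc.stronglyMeasurableAtFilter isOpen_Ioi t ht)
    (hc.continuousAt (Ioi_mem_nhds ht))).const_sub ρ
  refine h1.congr_of_eventuallyEq ?_
  filter_upwards [Ioi_mem_nhds ht] with r hr
  exact h.eq r (le_of_lt hr)

theorem sub_eq_integral (hA : Admissible α p γ f) (h : IsRegularSolution_s16 α p γ f ρ y)
    {a b : ℝ} (ha : 0 ≤ a) (hb : 0 ≤ b) : y b = y a - ∫ t in a..b, speed α p γ f y t := by
  rw [h.eq a ha, h.eq b hb, ← intervalIntegral.integral_interval_sub_left
    (h.integrable_speed hA hb) (h.integrable_speed hA ha)]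
  ring

theorem apply_zero (h : IsRegularSolution_s16 α p γ f ρ y) : y 0 = ρ := by
  simpa using h.eq 0 le_rfl

theorem antitone (hA : Admissible α p γ f) (h : IsRegularSolution_s16 α p γ f ρ y)
    {a b : ℝ} (ha : 0 ≤ a) (hab : a ≤ b) : y b ≤ y a := by
  rw [h.sub_eq_integral hA ha (ha.trans hab)]
  have : 0 ≤ ∫ t in a..b, speed α p γ f y t :=
    intervalIntegral.integral_nonneg hab fun x hx =>
      mul_nonneg (rpow_nonneg (ha.trans hx.1) _)
        (rpow_nonneg (h.mass_nonneg hA (ha.trans hx.1)) _)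
  linarith

theorem le_initial (hA : Admissible α p γ f) (h : IsRegularSolution_s16 α p γ f ρ y)
    {t : ℝ} (ht : 0 ≤ t) : y t ≤ ρ := by
  simpa [h.apply_zero] using h.antitone hA le_rfl ht

theorem mul_speed_le (hA : Admissible α p γ f) (h : IsRegularSolution_s16 α p γ f ρ y)
    {t : ℝ} (ht : 0 < t) :
    t * speed α p γ f y t ≤
      (Real.exp (f ρ) / (γ + 1)) ^ (1 / p) * t ^ scalingExponent α p γ := by
  have hγ := hA.gamma_pos
  have hs := speed_le hA (h.mass_nonneg hA ht.le) ht (by positivity)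
    (h.mass_le_of_le hA ht.le fun s hs => h.le_initial hA hs.1)
  refine (mul_le_mul_of_nonneg_left hs ht.le).trans (le_of_eq ?_)
  rw [rpow_sub_one ht.ne']
  field_simp

theorem continuousOn_mul_speed (hA : Admissible α p γ f) (h : IsRegularSolution_s16 α p γ f ρ y)
    (T : ℝ) : ContinuousOn (fun t => t * speed α p γ f y t) (Icc 0 T) := by
  intro t ht
  rcases ht.1.eq_or_lt with rfl | h0
  · have hσ := hA.scalingExponent_pos
    have hlim : Tendsto (fun t : ℝ => (Real.exp (f ρ) / (γ + 1)) ^ (1 / p) *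
        t ^ scalingExponent α p γ) (nhdsWithin 0 (Icc 0 T)) (nhds 0) := by
      have hc : ContinuousAt (fun t : ℝ => (Real.exp (f ρ) / (γ + 1)) ^ (1 / p) *
          t ^ scalingExponent α p γ) 0 :=
        continuousAt_const.mul (continuousAt_id.rpow_const (Or.inr hσ.le))
      have := hc.tendsto
      simp only [zero_rpow hσ.ne', mul_zero] at this
      exact this.mono_left nhdsWithin_le_nhds
    have : Tendsto (fun t => t * speed α p γ f y t) (nhdsWithin 0 (Icc 0 T)) (nhds 0) := by
      refine squeeze_zero' ?_ ?_ hlim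
      · filter_upwards [self_mem_nhdsWithin] with s hs
        exact mul_nonneg hs.1 (mul_nonneg (rpow_nonneg hs.1 _)
          (rpow_nonneg (h.mass_nonneg hA hs.1) _))
      · filter_upwards [self_mem_nhdsWithin] with s hs
        rcases hs.1.eq_or_lt with rfl | hs0
        · simp [zero_rpow hσ.ne']
        · exact h.mul_speed_le hA hs0
    simpa [ContinuousWithinAt] using this
  · exact (continuousAt_id.mul (h.hasDerivAt_speed hA h0).continuousAt).continuousWithinAt

/-- A Pohozaev-type estimate: above a threshold independent of the solution, the logarithmic
derivative of a regular solution is as small as desired. -/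
theorem exists_mul_speed_le (hA : Admissible α p γ f) {κ : ℝ} (hκ : 0 < κ)
    (hκa : κ ≤ α / p - 1) :
    ∃ M : ℝ, 1 ≤ M ∧ ∀ ρ y, IsRegularSolution_s16 α p γ f ρ y → ∀ r, 0 < r → M ≤ y r →
      r * speed α p γ f y r ≤ κ * y r := by
  have hγ := hA.gamma_pos
  have hp := hA.p_pos
  obtain ⟨μ, hμ⟩ : ∃ μ, μ = κ / (γ + 1) := ⟨_, rfl⟩
  have hμ0 : 0 < μ := by rw [hμ]; positivity
  obtain ⟨M, hM⟩ := (hA.deriv_growth.eventually_ge_atTop ((1 / p + 1) / μ)).exists_forall_of_atTop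
  refine ⟨max 1 M, le_max_left _ _, fun ρ y h r hr hyr => ?_⟩
  have hP := le_of_hasDerivAt_nonneg (a := 0) (b := r) (h := fun t => κ * (mass γ f y t * y t) -
      t * speed α p γ f y t * mass γ f y t - μ * (y t * (t ^ (γ + 1) * Real.exp (f (y t)))))
    (h' := fun t => speed α p γ f y t * mass γ f y t * (α / p - 1 - κ) +
      speed α p γ f y t * (t * (t ^ γ * Real.exp (f (y t)))) *
        (μ + μ * (y t * deriv f (y t)) - (1 / p + 1))) hr.le ?_ ?_ ?_
  · simp only [mass, intervalIntegral.integral_same, zero_rpow hγ.ne'] at hP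
    have hw := h.mass_pos hA hr
    have hy1 : 1 ≤ y r := (le_max_left _ _).trans hyr
    have h3 : 0 ≤ μ * (y r * (r ^ (γ + 1) * Real.exp (f (y r)))) := by positivity
    refine le_of_mul_le_mul_right ?_ hw
    simp only [mass] at *
    linarith
  · have hy := h.continuousOn.mono (Icc_subset_Ici_self : Icc 0 r ⊆ Ici 0)
    have hw := h.continuousOn_mass hA r
    have he := (h.continuousOn_exp hA).mono (Icc_subset_Ici_self : Icc 0 r ⊆ Ici 0)
    refine ((continuousOn_const.mul (hw.mul hy)).sub
      ((h.continuousOn_mul_speed hA r).mul hw)).sub (continuousOn_const.mul (hy.mul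
        ((continuousOn_id.rpow_const fun _ _ => Or.inr hγ.le).mul he)))
  · intro t ht
    have ht0 := ht.1
    have dw := h.hasDerivAt_mass hA ht0
    have dy := h.hasDerivAt hA ht0
    have dv := h.hasDerivAt_speed hA ht0
    have hw := h.mass_pos hA ht0
    have de : HasDerivAt (fun t => Real.exp (f (y t)))
        (Real.exp (f (y t)) * (deriv f (y t) * -speed α p γ f y t)) t :=
      (HasDerivAt.comp t (hA.hasDerivAt (y t)) dy).exp
    have dt := Real.hasDerivAt_rpow_const (x := t) (p := γ + 1) (Or.inl ht0.ne')
    refine ((((dw.mul dy).const_mul κ).sub (((hasDerivAt_id t).mul dv).mul dw)).sub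
      ((dy.mul (dt.mul de)).const_mul μ)).congr_deriv ?_
    have h1 : t ^ (γ + 1) = t * t ^ γ := by rw [rpow_add_one ht0.ne', mul_comm]
    simp only [add_sub_cancel_right, id_eq, h1, Pi.mul_apply]
    have hμ' : κ = μ * (γ + 1) := by rw [hμ]; field_simp
    rw [hμ']
    field_simp
    ring
  · intro t ht
    have ht0 := ht.1
    have hw := h.mass_pos hA ht0
    have hv := h.speed_pos hA ht0
    have hyt : M ≤ y t := (le_max_right _ _).trans (hyr.trans (h.antitone hA ht0.le ht.2.le))
    have h2 := (div_le_iff₀' hμ0).1 (hM _ hyt)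
    have h3 : 0 < t ^ γ * Real.exp (f (y t)) := mul_pos (rpow_pos_of_pos ht0 _) (Real.exp_pos _)
    have h4 : 0 ≤ speed α p γ f y t * (t * (t ^ γ * Real.exp (f (y t)))) := by positivity
    exact add_nonneg (mul_nonneg (mul_pos hv hw).le (by linarith))
      (mul_nonneg h4 (by linarith))

theorem mass_le_of_mul_speed_le (hA : Admissible α p γ f) (h : IsRegularSolution_s16 α p γ f ρ y)
    {r c : ℝ} (hr : 0 < r) (hc : r * speed α p γ f y r ≤ c) :
    mass γ f y r ≤ (c * r ^ (α / p - 1)) ^ p := by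
  have hp := hA.p_pos
  have hw := h.mass_pos hA hr
  have h1 : mass γ f y r = (r * speed α p γ f y r * r ^ (α / p - 1)) ^ p := by
    have : r * speed α p γ f y r * r ^ (α / p - 1) = mass γ f y r ^ (1 / p) := by
      rw [speed, rpow_sub_one hr.ne', rpow_neg hr.le]
      have := (rpow_pos_of_pos hr (α / p)).ne'
      field_simp
    rw [this, ← rpow_mul hw.le, one_div_mul_cancel hp.ne', rpow_one]
  rw [h1]
  refine rpow_le_rpow ?_ (mul_le_mul_of_nonneg_right hc (rpow_nonneg hr.le _)) hp.le
  exact mul_nonneg (mul_pos hr (h.speed_pos hA hr)).le (rpow_nonneg hr.le _)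

theorem exists_crossing (h : IsRegularSolution_s16 α p γ f ρ y)
    {r m : ℝ} (hr : 0 < r) (hm : m < ρ) (hy : y r ≤ m) : ∃ R, 0 < R ∧ R ≤ r ∧ y R = m := by
  obtain ⟨R, hR, hRm⟩ := intermediate_value_Icc' hr.le
    (h.continuousOn.mono (Icc_subset_Ici_self : Icc 0 r ⊆ Ici 0))
    (show m ∈ Icc (y r) (y 0) from ⟨hy, by rw [h.apply_zero]; exact hm.le⟩)
  refine ⟨R, hR.1.lt_of_ne ?_, hR.2, hRm⟩
  rintro rfl
  rw [h.apply_zero] at hRm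
  exact hm.ne' hRm

theorem mass_le_after_crossing (hA : Admissible α p γ f) (h : IsRegularSolution_s16 α p γ f ρ y)
    {R t m c : ℝ} (hR : 0 < R) (hRt : R ≤ t) (hm : y R ≤ m)
    (hc : R * speed α p γ f y R ≤ c) :
    mass γ f y t ≤ (c * R ^ (α / p - 1)) ^ p + Real.exp (f m) / (γ + 1) * t ^ (γ + 1) := by
  rw [h.mass_sub hA hR.le (hR.le.trans hRt)]
  exact add_le_add (h.mass_le_of_mul_speed_le hA hR hc)
    (h.integral_le hA hR.le hRt fun s hs => (h.antitone hA hR.le hs.1).trans hm)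

/-- Regular solutions are bounded above at each positive radius, uniformly in the initial value. -/
theorem exists_upper_bound (hA : Admissible α p γ f) :
    ∃ K : ℝ → ℝ, ∀ ρ y, IsRegularSolution_s16 α p γ f ρ y → ∀ r, 0 < r → y r ≤ K r := by
  have hγ := hA.gamma_pos
  have hp := hA.p_pos
  obtain ⟨M, hM1, hM⟩ := exists_mul_speed_le hA hA.decay_pos le_rfl
  have hex : ∀ A : ℝ, ∃ N : ℝ, ∀ u, N ≤ u → A < Real.exp (f u / p) / u := fun A =>
    (hA.exp_growth.eventually_gt_atTop A).exists_forall_of_atTop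
  choose N hN using hex
  refine ⟨fun r => max M (N ((α / p - 1) * (γ + 1) ^ (1 / p) / r ^ scalingExponent α p γ)),
    fun ρ y h r hr => ?_⟩
  by_contra! hlt
  obtain ⟨h1, h2⟩ := max_lt_iff.1 hlt
  have h3 := hN _ _ h2.le
  have h4 := hM ρ y h r hr h1.le
  have hy : 0 < y r := by linarith
  have hrσ := rpow_pos_of_pos hr (scalingExponent α p γ)
  have hgp := rpow_pos_of_pos hγ (1 / p)
  have h5 : Real.exp (f (y r) / p) / (γ + 1) ^ (1 / p) * r ^ scalingExponent α p γ ≤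
      r * speed α p γ f y r := by
    have hle := h.le_mass_of_le hA hr.le fun s hs => h.antitone hA hs.1 hs.2
    have h6 : r ^ (-(α / p)) * (Real.exp (f (y r)) / (γ + 1) * r ^ (γ + 1)) ^ (1 / p) ≤
        speed α p γ f y r :=
      mul_le_mul_of_nonneg_left (rpow_le_rpow (by positivity) hle (by positivity))
        (rpow_nonneg hr.le _)
    rw [hA.rpow_mul_rpow hr (by positivity), div_rpow (Real.exp_pos _).le hγ.le,
      ← Real.exp_mul, mul_one_div, rpow_sub_one hr.ne'] at h6
    have h7 := mul_le_mul_of_nonneg_left h6 hr.le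
    refine le_trans (le_of_eq ?_) h7
    field_simp
  have h6 := h5.trans h4
  rw [div_lt_div_iff₀ hrσ hy] at h3
  rw [div_mul_eq_mul_div, div_le_iff₀ hgp] at h6
  linarith

/-- The mass of regular solutions is bounded uniformly in the initial value. -/
theorem exists_mass_bound (hA : Admissible α p γ f) :
    ∃ W : ℝ → ℝ, ∀ ρ y, IsRegularSolution_s16 α p γ f ρ y → ∀ r, 0 < r → mass γ f y r ≤ W r := by
  have hγ := hA.gamma_pos
  have hp := hA.p_pos
  have ha := hA.decay_pos
  obtain ⟨M, hM1, hM⟩ := exists_mul_speed_le hA hA.decay_pos le_rfl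
  obtain ⟨K, hK⟩ := exists_upper_bound hA
  refine ⟨fun r => ((α / p - 1) * max (K r) M * r ^ (α / p - 1)) ^ p +
    Real.exp (f M) / (γ + 1) * r ^ (γ + 1), fun ρ y h r hr => ?_⟩
  have hmax : 0 ≤ max (K r) M := le_trans (by linarith) (le_max_right _ _)
  have hra := rpow_nonneg hr.le (α / p - 1)
  have hE : 0 ≤ Real.exp (f M) / (γ + 1) * r ^ (γ + 1) := by positivity
  rcases le_total M (y r) with h1 | h1
  · have h2 := h.mass_le_of_mul_speed_le hA hr (c := (α / p - 1) * max (K r) M)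
      ((hM ρ y h r hr h1).trans (mul_le_mul_of_nonneg_left
        ((hK ρ y h r hr).trans (le_max_left _ _)) ha.le))
    linarith
  rcases le_or_gt ρ M with h2 | h2
  · have h3 := h.mass_le_of_le hA hr.le fun s hs => (h.le_initial hA hs.1).trans h2
    have : 0 ≤ ((α / p - 1) * max (K r) M * r ^ (α / p - 1)) ^ p := by positivity
    linarith
  · obtain ⟨R, hR, hRr, hyR⟩ := h.exists_crossing hr h2 h1
    refine (h.mass_le_after_crossing hA hR hRr hyR.le (hM ρ y h R hR hyR.ge)).trans ?_
    rw [hyR]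
    beta_reduce
    gcongr
    exact le_max_right _ _

theorem lower_bound_of_le (hA : Admissible α p γ f) (h : IsRegularSolution_s16 α p γ f ρ y)
    {r m : ℝ} (hr : 0 ≤ r) (hm : ρ ≤ m) :
    ρ - (Real.exp (f m) / (γ + 1)) ^ (1 / p) / scalingExponent α p γ *
      r ^ scalingExponent α p γ ≤ y r := by
  have hγ := hA.gamma_pos
  have hσ := hA.scalingExponent_pos
  have hmono := le_of_hasDerivAt_nonneg (a := 0) (b := r)
    (h := fun t => y t + (Real.exp (f m) / (γ + 1)) ^ (1 / p) / scalingExponent α p γ *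
      t ^ scalingExponent α p γ)
    (h' := fun t => -speed α p γ f y t + (Real.exp (f m) / (γ + 1)) ^ (1 / p) *
      t ^ (scalingExponent α p γ - 1)) hr ?_ ?_ ?_
  · simp only [zero_rpow hσ.ne', h.apply_zero] at hmono
    linarith
  · exact (h.continuousOn.mono Icc_subset_Ici_self).add
      (continuousOn_const.mul (continuousOn_id.rpow_const fun _ _ => Or.inr hσ.le))
  · intro t ht
    refine ((h.hasDerivAt hA ht.1).add ((Real.hasDerivAt_rpow_const
      (Or.inl ht.1.ne')).const_mul _)).congr_deriv ?_
    field_simp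
  · intro t ht
    have := speed_le hA (h.mass_nonneg hA ht.1.le) ht.1 (by positivity)
      (h.mass_le_of_le hA ht.1.le fun s hs => (h.le_initial hA hs.1).trans hm)
    linarith

theorem add_rpow_le {x y q : ℝ} (hx : 0 ≤ x) (hy : 0 ≤ y) (hq : 0 ≤ q) :
    (x + y) ^ q ≤ 2 ^ q * (x ^ q + y ^ q) := by
  have hm : 0 ≤ max x y := le_max_of_le_left hx
  calc (x + y) ^ q ≤ (2 * max x y) ^ q :=
        rpow_le_rpow (by positivity) (by linarith [le_max_left x y, le_max_right x y]) hq
    _ = 2 ^ q * max x y ^ q := mul_rpow (by norm_num) hm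
    _ ≤ 2 ^ q * (x ^ q + y ^ q) := by
        refine mul_le_mul_of_nonneg_left ?_ (by positivity)
        rcases max_choice x y with h | h <;> rw [h] <;>
          linarith [rpow_nonneg hx q, rpow_nonneg hy q]

/-- A solution that crosses a level at a controlled speed stays close to that level. -/
theorem lower_bound_after_crossing (hA : Admissible α p γ f)
    (h : IsRegularSolution_s16 α p γ f ρ y) {R r c : ℝ} (hR : 0 < R) (hRr : R ≤ r)
    (hc0 : 0 ≤ c) (hc : R * speed α p γ f y R ≤ c) :
    y R - 2 ^ (1 / p) * c / (α / p - 1) - 2 ^ (1 / p) *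
      (Real.exp (f (y R)) / (γ + 1)) ^ (1 / p) / scalingExponent α p γ *
        r ^ scalingExponent α p γ ≤ y r := by
  have hγ := hA.gamma_pos
  have hp := hA.p_pos
  have hσ := hA.scalingExponent_pos
  have ha := hA.decay_pos
  obtain ⟨a, haa⟩ : ∃ a, a = α / p - 1 := ⟨_, rfl⟩
  obtain ⟨A, hAA⟩ : ∃ A, A = 2 ^ (1 / p) * c * R ^ a := ⟨_, rfl⟩
  obtain ⟨B, hB⟩ : ∃ B, B = 2 ^ (1 / p) * (Real.exp (f (y R)) / (γ + 1)) ^ (1 / p) := ⟨_, rfl⟩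
  have hA0 : 0 ≤ A := by rw [hAA]; positivity
  have hB0 : 0 ≤ B := by rw [hB]; positivity
  rw [← haa] at ha
  have hmono := le_of_hasDerivAt_nonneg (a := R) (b := r)
    (h := fun t => y t + (-(A / a) * t ^ (-a) +
      B / scalingExponent α p γ * t ^ scalingExponent α p γ))
    (h' := fun t => -speed α p γ f y t +
      (A * t ^ (-a - 1) + B * t ^ (scalingExponent α p γ - 1))) hRr ?_ ?_ ?_
  · have h1 : A / a * R ^ (-a) = 2 ^ (1 / p) * c / a := by
      have := (rpow_pos_of_pos hR a).ne'
      rw [hAA, rpow_neg hR.le]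
      field_simp
    have h2 : 0 ≤ A / a * r ^ (-a) := by
      have := hR.trans_le hRr
      positivity
    have h3 : 0 ≤ B / scalingExponent α p γ * R ^ scalingExponent α p γ := by positivity
    rw [← haa, ← hB]
    simp only [neg_mul, h1] at hmono
    linarith
  · have hne : ∀ x ∈ Icc R r, x ≠ 0 := fun x hx => (hR.trans_le hx.1).ne'
    exact (h.continuousOn.mono fun x hx => hR.le.trans hx.1).add
      ((continuousOn_const.mul (continuousOn_id.rpow_const fun x hx => Or.inl (hne x hx))).add
        (continuousOn_const.mul (continuousOn_id.rpow_const fun x hx => Or.inl (hne x hx))))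
  · intro t ht
    have ht0 := hR.trans ht.1
    refine ((h.hasDerivAt hA ht0).add
      (((Real.hasDerivAt_rpow_const (Or.inl ht0.ne')).const_mul (-(A / a))).add
        ((Real.hasDerivAt_rpow_const (Or.inl ht0.ne')).const_mul
          (B / scalingExponent α p γ)))).congr_deriv ?_
    field_simp
  · intro t ht
    have ht0 := hR.trans ht.1
    have hE : 0 ≤ Real.exp (f (y R)) / (γ + 1) := by positivity
    have hcR : 0 ≤ c * R ^ a := by positivity
    have h1 := h.mass_le_after_crossing hA hR ht.1.le le_rfl hc
    rw [← haa] at h1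
    have h2 : mass γ f y t ^ (1 / p) ≤ 2 ^ (1 / p) * (c * R ^ a +
        (Real.exp (f (y R)) / (γ + 1) * t ^ (γ + 1)) ^ (1 / p)) := by
      refine (rpow_le_rpow (h.mass_nonneg hA ht0.le) h1 (by positivity)).trans ?_
      refine (add_rpow_le (by positivity) (by positivity) (by positivity)).trans (le_of_eq ?_)
      rw [← rpow_mul hcR, mul_one_div_cancel hp.ne', rpow_one]
    have h3 : speed α p γ f y t ≤ A * t ^ (-a - 1) + B * t ^ (scalingExponent α p γ - 1) := by
      refine (mul_le_mul_of_nonneg_left h2 (rpow_nonneg ht0.le (-(α / p)))).trans (le_of_eq ?_)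
      rw [hB, mul_assoc, ← hA.rpow_mul_rpow ht0 hE, hAA, haa]
      ring_nf
    linarith

/-- Solutions starting above a large level `m` stay above `m / 2` near the origin, uniformly in
the initial value. -/
theorem exists_lower_bound (hA : Admissible α p γ f) :
    ∃ M : ℝ, 1 ≤ M ∧ ∀ m, M ≤ m → ∃ E : ℝ, 0 ≤ E ∧
      ∀ ρ y, IsRegularSolution_s16 α p γ f ρ y → m < ρ → ∀ r, 0 < r →
        m / 2 - E * r ^ scalingExponent α p γ ≤ y r := by
  have hγ := hA.gamma_pos
  have hp := hA.p_pos
  have ha := hA.decay_pos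
  have hσ := hA.scalingExponent_pos
  have h2 : (1 : ℝ) ≤ 2 ^ (1 / p) := one_le_rpow (by norm_num) (by positivity)
  obtain ⟨M, hM1, hM⟩ := exists_mul_speed_le hA (κ := (α / p - 1) / (2 * 2 ^ (1 / p)))
    (by positivity) (div_le_self ha.le (by linarith))
  refine ⟨M, hM1, fun m hm => ⟨2 ^ (1 / p) * (Real.exp (f m) / (γ + 1)) ^ (1 / p) /
    scalingExponent α p γ, by positivity, fun ρ y h hρ r hr => ?_⟩⟩
  rcases le_total m (y r) with h1 | h1
  · have : 0 ≤ 2 ^ (1 / p) * (Real.exp (f m) / (γ + 1)) ^ (1 / p) / scalingExponent α p γ *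
      r ^ scalingExponent α p γ := by positivity
    linarith
  · obtain ⟨R, hR, hRr, hyR⟩ := h.exists_crossing hr hρ h1
    have h3 := h.lower_bound_after_crossing hA hR hRr
      (mul_nonneg (by positivity) (by linarith)) (hM ρ y h R hR (hm.trans hyR.ge))
    rw [hyR] at h3
    have h4 : 2 ^ (1 / p) * ((α / p - 1) / (2 * 2 ^ (1 / p)) * m) / (α / p - 1) = m / 2 := by
      have := ha.ne'
      generalize α / p - 1 = a at this
      field_simp
    rw [h4] at h3
    linarith

/-- Solutions with nonnegative initial value are bounded below uniformly. -/
theorem exists_uniform_lower_bound (hA : Admissible α p γ f) :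
    ∃ E : ℝ, ∀ ρ y, IsRegularSolution_s16 α p γ f ρ y → 0 ≤ ρ → ∀ r, 0 < r →
      -(E * r ^ scalingExponent α p γ) ≤ y r := by
  obtain ⟨M, hM1, hM⟩ := exists_lower_bound hA
  obtain ⟨E, hE, hlow⟩ := hM M le_rfl
  refine ⟨max E ((Real.exp (f M) / (γ + 1)) ^ (1 / p) / scalingExponent α p γ),
    fun ρ y h hρ r hr => ?_⟩
  have hrσ := rpow_nonneg hr.le (scalingExponent α p γ)
  rcases lt_or_ge M ρ with h1 | h1
  · have := hlow ρ y h h1 r hr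
    have := mul_le_mul_of_nonneg_right (le_max_left E
      ((Real.exp (f M) / (γ + 1)) ^ (1 / p) / scalingExponent α p γ)) hrσ
    linarith
  · have := h.lower_bound_of_le hA hr.le h1
    have := mul_le_mul_of_nonneg_right (le_max_right E
      ((Real.exp (f M) / (γ + 1)) ^ (1 / p) / scalingExponent α p γ)) hrσ
    linarith

/-- On compact subintervals of `(0, ∞)` regular solutions are Lipschitz, uniformly in the initial
value. -/
theorem exists_speed_bound (hA : Admissible α p γ f) {a b : ℝ} (ha : 0 < a) (hab : a ≤ b) :
    ∃ C : ℝ, 0 ≤ C ∧ ∀ ρ y, IsRegularSolution_s16 α p γ f ρ y → ∀ t ∈ Icc a b,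
      |speed α p γ f y t| ≤ C := by
  have hp := hA.p_pos
  obtain ⟨W, hW⟩ := exists_mass_bound hA
  refine ⟨a ^ (-(α / p)) * max 0 (W b) ^ (1 / p), by positivity, fun ρ y h t ht => ?_⟩
  have ht0 := ha.trans_le ht.1
  rw [abs_of_pos (h.speed_pos hA ht0)]
  refine mul_le_mul (rpow_le_rpow_of_nonpos ha ht.1 ?_) (rpow_le_rpow (h.mass_nonneg hA ht0.le)
    (((h.mass_mono hA ht0.le ht.2).trans (hW ρ y h b (ha.trans_le hab))).trans (le_max_right _ _))
      (by positivity)) (rpow_nonneg (h.mass_nonneg hA ht0.le) _) (by positivity)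
  linarith [hA.decay_pos]

theorem exists_lipschitz_bound (hA : Admissible α p γ f) {a b : ℝ} (ha : 0 < a) (hab : a ≤ b) :
    ∃ C : ℝ, 0 ≤ C ∧ ∀ ρ y, IsRegularSolution_s16 α p γ f ρ y → ∀ s ∈ Icc a b, ∀ t ∈ Icc a b,
      |y s - y t| ≤ C * |s - t| := by
  obtain ⟨C, hC, hb⟩ := exists_speed_bound hA ha hab
  refine ⟨C, hC, fun ρ y h s hs t ht => ?_⟩
  refine Convex.norm_image_sub_le_of_norm_hasDerivWithin_le
    (fun x hx => (h.hasDerivAt hA (ha.trans_le hx.1)).hasDerivWithinAt) (fun x hx => ?_)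
    (convex_Icc a b) ht hs
  rw [norm_neg]
  exact hb ρ y h x hx

/-- Relative compactness of the family of regular solutions in `C([a, b])`. -/
theorem exists_tendstoUniformlyOn_subseq (hA : Admissible α p γ f) {a b : ℝ} (ha : 0 < a)
    (hab : a ≤ b) {ρ : ℕ → ℝ} {y : ℕ → ℝ → ℝ}
    (h : ∀ n, IsRegularSolution_s16 α p γ f (ρ n) (y n)) (hρ : ∀ n, 0 ≤ ρ n) :
    ∃ φ : ℕ → ℕ, ∃ v : ℝ → ℝ, StrictMono φ ∧ ContinuousOn v (Icc a b) ∧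
      TendstoUniformlyOn (fun n => y (φ n)) v atTop (Icc a b) := by
  obtain ⟨C, hC, hlip⟩ := exists_lipschitz_bound hA ha hab
  obtain ⟨K, hK⟩ := exists_upper_bound hA
  obtain ⟨E, hE⟩ := exists_uniform_lower_bound hA
  let F : ℕ → BoundedContinuousFunction (Icc a b) ℝ := fun n =>
    BoundedContinuousFunction.mkOfCompact ⟨fun x => y n x,
      continuousOn_iff_continuous_domRestrict.1 ((h n).continuousOn.mono
        fun x hx => ha.le.trans hx.1)⟩
  have hF : ∀ n x, F n x = y n x := fun n x => rfl
  have hcomp := BoundedContinuousFunction.arzela_ascoli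
    (Icc (-(E * b ^ scalingExponent α p γ)) (K a)) isCompact_Icc (range F) ?_ ?_
  · obtain ⟨G, -, φ, hφ, hG⟩ := hcomp.tendsto_subseq
      (fun n => subset_closure (mem_range_self (f := F) n))
    rw [BoundedContinuousFunction.tendsto_iff_tendstoUniformly] at hG
    have hext : IccExtend hab G ∘ Subtype.val = G := funext fun x => IccExtend_val hab G x
    refine ⟨φ, IccExtend hab G, hφ, (G.continuous.Icc_extend').continuousOn, ?_⟩
    rw [tendstoUniformlyOn_iff_tendstoUniformly_comp_coe, hext]
    exact hG
  · rintro g x ⟨n, rfl⟩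
    have hx := x.2
    refine ⟨(hE _ _ (h n) (hρ n) b (ha.trans_le hab)).trans
      ((h n).antitone hA (ha.le.trans hx.1) hx.2), ?_⟩
    exact ((h n).antitone hA ha.le hx.1).trans (hK _ _ (h n) a ha)
  · refine Metric.equicontinuous_of_continuity_modulus (fun d => C * d) ?_ _ ?_
    · have : ContinuousAt (fun d : ℝ => C * d) 0 := by fun_prop
      simpa using this.tendsto
    · rintro s t ⟨_, n, rfl⟩
      exact hlip _ _ (h n) s s.2 t t.2

/-- The weighted estimate behind continuous dependence: a bound for the difference of two
solutions reproduces itself with a small factor. -/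
theorem abs_sub_le_of_weighted_bound (hA : Admissible α p γ f) {y₁ y₂ : ℝ → ℝ} {ρ₁ ρ₂ : ℝ}
    (h₁ : IsRegularSolution_s16 α p γ f ρ₁ y₁) (h₂ : IsRegularSolution_s16 α p γ f ρ₂ y₂)
    {T K lam N : ℝ} (hN : 0 ≤ N)
    (hlam : lam * scalingExponent α p γ = 2 * K)
    (hv : ∀ t ∈ Ioo 0 T, |speed α p γ f y₁ t - speed α p γ f y₂ t| ≤
      K * N * (t ^ (scalingExponent α p γ - 1) * Real.exp (lam * t ^ scalingExponent α p γ)))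
    {r : ℝ} (hr : r ∈ Icc 0 T) :
    |y₁ r - y₂ r| ≤ |ρ₁ - ρ₂| + N / 2 * Real.exp (lam * r ^ scalingExponent α p γ) := by
  have hσ := hA.scalingExponent_pos
  have key : ∀ {z₁ z₂ : ℝ → ℝ} {q₁ q₂ : ℝ}, IsRegularSolution_s16 α p γ f q₁ z₁ →
      IsRegularSolution_s16 α p γ f q₂ z₂ →
      (∀ t ∈ Ioo 0 T, speed α p γ f z₁ t - speed α p γ f z₂ t ≤
        K * N * (t ^ (scalingExponent α p γ - 1) *
          Real.exp (lam * t ^ scalingExponent α p γ))) →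
      z₂ r - z₁ r ≤ q₂ - q₁ + N / 2 * Real.exp (lam * r ^ scalingExponent α p γ) := by
    intro z₁ z₂ q₁ q₂ k₁ k₂ hk
    have hmono := le_of_hasDerivAt_nonneg (a := 0) (b := r)
      (h := fun t => z₁ t - z₂ t + N / 2 * Real.exp (lam * t ^ scalingExponent α p γ))
      (h' := fun t => -speed α p γ f z₁ t - -speed α p γ f z₂ t + K * N *
        (t ^ (scalingExponent α p γ - 1) * Real.exp (lam * t ^ scalingExponent α p γ)))
      hr.1 ?_ ?_ ?_
    · simp only [k₁.apply_zero, k₂.apply_zero, zero_rpow hσ.ne', mul_zero, Real.exp_zero] at hmono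
      linarith
    · refine ((k₁.continuousOn.mono Icc_subset_Ici_self).sub
        (k₂.continuousOn.mono Icc_subset_Ici_self)).add (continuousOn_const.mul
          (Real.continuous_exp.comp_continuousOn (continuousOn_const.mul
            (continuousOn_id.rpow_const fun _ _ => Or.inr hσ.le))))
    · intro t ht
      refine (((k₁.hasDerivAt hA ht.1).sub (k₂.hasDerivAt hA ht.1)).add
        ((((Real.hasDerivAt_rpow_const (Or.inl ht.1.ne')).const_mul lam).exp).const_mul
          (N / 2))).congr_deriv ?_
      have hKe : K = lam * scalingExponent α p γ / 2 := by linarith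
      rw [hKe]
      ring
    · intro t ht
      linarith [hk t ⟨ht.1, ht.2.trans_le hr.2⟩]
  have e₁ := key h₁ h₂ fun t ht => (le_abs_self _).trans (hv t ht)
  have e₂ := key h₂ h₁ fun t ht => (le_abs_self _).trans (by rw [abs_sub_comm]; exact hv t ht)
  have := le_abs_self (ρ₁ - ρ₂)
  have := neg_abs_le (ρ₁ - ρ₂)
  rw [abs_le]
  constructor <;> linarith

/-- Lipschitz dependence of regular solutions on the initial value, on bounded sets. -/
theorem exists_lipschitz_dependence (hA : Admissible α p γ f) (B : ℝ) {T : ℝ} (hT : 0 < T) :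
    ∃ C : ℝ, ∀ ρ₁ y₁ ρ₂ y₂, IsRegularSolution_s16 α p γ f ρ₁ y₁ → IsRegularSolution_s16 α p γ f ρ₂ y₂ →
      ρ₁ ∈ Icc 0 B → ρ₂ ∈ Icc 0 B → |y₁ T - y₂ T| ≤ C * |ρ₁ - ρ₂| := by
  have hγ := hA.gamma_pos
  have hp := hA.p_pos
  have hσ := hA.scalingExponent_pos
  obtain ⟨lo, hlo⟩ : ∃ lo, lo = -((Real.exp (f B) / (γ + 1)) ^ (1 / p) /
    scalingExponent α p γ * T ^ scalingExponent α p γ) := ⟨_, rfl⟩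
  have hrange : ∀ ρ y, IsRegularSolution_s16 α p γ f ρ y → ρ ∈ Icc 0 B → ∀ t ∈ Icc 0 T,
      y t ∈ Icc lo B := by
    intro ρ y h hρ t ht
    refine ⟨le_trans ?_ (h.antitone hA ht.1 ht.2), (h.le_initial hA ht.1).trans hρ.2⟩
    have := h.lower_bound_of_le hA hT.le hρ.2
    rw [hlo]
    linarith [hρ.1]
  have hcexp : ContDiff ℝ 1 (fun x => Real.exp (f x)) := hA.contDiff.exp
  obtain ⟨L, hL, hLip⟩ := exists_lipschitz_bound_Icc (g := fun x => Real.exp (f x))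
    (a := lo) (b := B) (fun x _ => hcexp.differentiable (by simp) x)
    (hcexp.continuous_deriv le_rfl).continuousOn
  have hlopos : 0 < Real.exp (f lo) / (γ + 1) := by positivity
  obtain ⟨L', hL', hLip'⟩ := exists_lipschitz_bound_Icc (g := fun x : ℝ => x ^ (1 / p))
    (a := Real.exp (f lo) / (γ + 1)) (b := Real.exp (f B) / (γ + 1))
    (fun x hx => (Real.hasDerivAt_rpow_const
      (Or.inl (hlopos.trans_le hx.1).ne')).differentiableAt) (by
      refine ContinuousOn.congr (f := fun x : ℝ => 1 / p * x ^ (1 / p - 1)) ?_ fun x hx =>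
        (Real.hasDerivAt_rpow_const (Or.inl (hlopos.trans_le hx.1).ne')).deriv
      exact continuousOn_const.mul (continuousOn_id.rpow_const fun x hx =>
        Or.inl (hlopos.trans_le hx.1).ne'))
  obtain ⟨K, hK⟩ : ∃ K, K = L' * (L / (γ + 1)) + 1 := ⟨_, rfl⟩
  have hK0 : 0 < K := by rw [hK]; positivity
  obtain ⟨lam, hlam⟩ : ∃ lam, lam = 2 * K / scalingExponent α p γ := ⟨_, rfl⟩
  have hlam0 : 0 ≤ lam := by rw [hlam]; positivity
  refine ⟨2 * Real.exp (lam * T ^ scalingExponent α p γ), fun ρ₁ y₁ ρ₂ y₂ h₁ h₂ hρ₁ hρ₂ => ?_⟩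
  have hcont : ContinuousOn (fun t => |y₁ t - y₂ t| *
      Real.exp (-(lam * t ^ scalingExponent α p γ))) (Icc 0 T) :=
    ((h₁.continuousOn.mono Icc_subset_Ici_self).sub
      (h₂.continuousOn.mono Icc_subset_Ici_self)).abs.mul
      (Real.continuous_exp.comp_continuousOn (continuousOn_const.mul
        (continuousOn_id.rpow_const fun _ _ => Or.inr hσ.le)).neg)
  obtain ⟨t₀, ht₀, hmax⟩ := isCompact_Icc.exists_isMaxOn (nonempty_Icc.2 hT.le) hcont
  obtain ⟨N, hN⟩ : ∃ N, N = |y₁ t₀ - y₂ t₀| * Real.exp (-(lam * t₀ ^ scalingExponent α p γ)) :=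
    ⟨_, rfl⟩
  have hN0 : 0 ≤ N := by rw [hN]; positivity
  have hdiff : ∀ t ∈ Icc 0 T, |y₁ t - y₂ t| ≤ N * Real.exp (lam * t ^ scalingExponent α p γ) := by
    intro t ht
    have := isMaxOn_iff.1 hmax t ht
    beta_reduce at this
    rw [← hN, Real.exp_neg, ← div_eq_mul_inv, div_le_iff₀ (Real.exp_pos _)] at this
    exact this
  have hmass : ∀ t ∈ Icc 0 T, |mass γ f y₁ t - mass γ f y₂ t| ≤
      L * N * Real.exp (lam * t ^ scalingExponent α p γ) / (γ + 1) * t ^ (γ + 1) := by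
    intro t ht
    have h3 : mass γ f y₁ t - mass γ f y₂ t = ∫ s in (0 : ℝ)..t,
        (s ^ γ * Real.exp (f (y₁ s)) - s ^ γ * Real.exp (f (y₂ s))) :=
      (intervalIntegral.integral_sub (h₁.integrable_density hA le_rfl ht.1)
        (h₂.integrable_density hA le_rfl ht.1)).symm
    rw [h3, ← Real.norm_eq_abs]
    refine (intervalIntegral.norm_integral_le_of_norm_le
      (g := fun s => s ^ γ * (L * N * Real.exp (lam * t ^ scalingExponent α p γ))) ht.1
      (Eventually.of_forall fun s hs => ?_)
      ((intervalIntegral.intervalIntegrable_rpow' (by linarith)).mul_const _)).trans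
        (le_of_eq ?_)
    · have hsT : s ∈ Icc 0 T := ⟨hs.1.le, hs.2.trans ht.2⟩
      rw [← mul_sub, norm_mul, Real.norm_of_nonneg (rpow_nonneg hs.1.le _), Real.norm_eq_abs]
      refine mul_le_mul_of_nonneg_left ?_ (rpow_nonneg hs.1.le _)
      refine (hLip _ (hrange _ _ h₁ hρ₁ s hsT) _ (hrange _ _ h₂ hρ₂ s hsT)).trans ?_
      rw [mul_assoc]
      refine mul_le_mul_of_nonneg_left ((hdiff s hsT).trans (mul_le_mul_of_nonneg_left
        (Real.exp_le_exp.2 (mul_le_mul_of_nonneg_left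
          (rpow_le_rpow hs.1.le hs.2 hσ.le) hlam0)) hN0)) hL
    · rw [intervalIntegral.integral_mul_const, integral_rpow (Or.inl (by linarith)),
        zero_rpow hγ.ne', sub_zero]
      ring
  have hspeed : ∀ t ∈ Ioo 0 T, |speed α p γ f y₁ t - speed α p γ f y₂ t| ≤
      K * N * (t ^ (scalingExponent α p γ - 1) *
        Real.exp (lam * t ^ scalingExponent α p γ)) := by
    intro t ht
    have htT : t ∈ Icc 0 T := ⟨ht.1.le, ht.2.le⟩
    have htg := rpow_pos_of_pos ht.1 (γ + 1)
    have hω : ∀ ρ y, IsRegularSolution_s16 α p γ f ρ y → ρ ∈ Icc 0 B →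
        mass γ f y t / t ^ (γ + 1) ∈
          Icc (Real.exp (f lo) / (γ + 1)) (Real.exp (f B) / (γ + 1)) ∧
        speed α p γ f y t = t ^ (scalingExponent α p γ - 1) *
          (mass γ f y t / t ^ (γ + 1)) ^ (1 / p) := by
      intro ρ y h hρ
      refine ⟨⟨?_, ?_⟩, ?_⟩
      · rw [le_div_iff₀ htg]
        exact h.le_mass_of_le hA ht.1.le fun s hs =>
          (hrange _ _ h hρ s ⟨hs.1, hs.2.trans ht.2.le⟩).1
      · rw [div_le_iff₀ htg]
        exact h.mass_le_of_le hA ht.1.le fun s hs =>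
          (hrange _ _ h hρ s ⟨hs.1, hs.2.trans ht.2.le⟩).2
      · rw [mul_comm, ← hA.rpow_mul_rpow ht.1 (div_nonneg (h.mass_nonneg hA ht.1.le) htg.le),
          div_mul_cancel₀ _ htg.ne', speed]
    obtain ⟨m₁, s₁⟩ := hω _ _ h₁ hρ₁
    obtain ⟨m₂, s₂⟩ := hω _ _ h₂ hρ₂
    have hpow := hLip' _ m₁ _ m₂
    have hquot : |mass γ f y₁ t / t ^ (γ + 1) - mass γ f y₂ t / t ^ (γ + 1)| ≤
        L * N * Real.exp (lam * t ^ scalingExponent α p γ) / (γ + 1) := by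
      rw [← sub_div, abs_div, abs_of_pos htg, div_le_iff₀ htg]
      exact hmass t htT
    have hσt := rpow_nonneg ht.1.le (scalingExponent α p γ - 1)
    rw [s₁, s₂, ← mul_sub, abs_mul, abs_of_nonneg hσt]
    calc _ ≤ t ^ (scalingExponent α p γ - 1) *
          (L' * (L * N * Real.exp (lam * t ^ scalingExponent α p γ) / (γ + 1))) :=
        mul_le_mul_of_nonneg_left (hpow.trans (mul_le_mul_of_nonneg_left hquot hL')) hσt
      _ = L' * (L / (γ + 1)) * (N * (t ^ (scalingExponent α p γ - 1) *
          Real.exp (lam * t ^ scalingExponent α p γ))) := by ring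
      _ ≤ K * (N * (t ^ (scalingExponent α p γ - 1) *
          Real.exp (lam * t ^ scalingExponent α p γ))) :=
        mul_le_mul_of_nonneg_right (by rw [hK]; linarith) (by positivity)
      _ = _ := by ring
  have hlamK : lam * scalingExponent α p γ = 2 * K := by rw [hlam]; field_simp
  have hself := h₁.abs_sub_le_of_weighted_bound hA h₂ hN0 hlamK hspeed ht₀
  have hN2 : N ≤ 2 * |ρ₁ - ρ₂| := by
    have he : 1 ≤ Real.exp (lam * t₀ ^ scalingExponent α p γ) :=
      Real.one_le_exp (mul_nonneg hlam0 (rpow_nonneg ht₀.1 _))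
    have hNe : |y₁ t₀ - y₂ t₀| = N * Real.exp (lam * t₀ ^ scalingExponent α p γ) := by
      rw [hN, mul_assoc, ← Real.exp_add, neg_add_cancel, Real.exp_zero, mul_one]
    rw [hNe] at hself
    have h5 : N / 2 * 1 ≤ N / 2 * Real.exp (lam * t₀ ^ scalingExponent α p γ) :=
      mul_le_mul_of_nonneg_left he (by positivity)
    linarith
  calc |y₁ T - y₂ T| ≤ N * Real.exp (lam * T ^ scalingExponent α p γ) := hdiff T ⟨hT.le, le_rfl⟩
    _ ≤ 2 * |ρ₁ - ρ₂| * Real.exp (lam * T ^ scalingExponent α p γ) :=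
      mul_le_mul_of_nonneg_right hN2 (Real.exp_pos _).le
    _ = _ := by ring

/-- Pointwise limits of regular solutions with convergent initial values are regular. -/
theorem eq_of_tendsto_initial (hA : Admissible α p γ f) {ρn : ℕ → ℝ} {yn : ℕ → ℝ → ℝ}
    (hn : ∀ n, IsRegularSolution_s16 α p γ f (ρn n) (yn n)) (hρn : ∀ n, 0 ≤ ρn n)
    (h : IsRegularSolution_s16 α p γ f ρ y) (hlim : Tendsto ρn atTop (nhds ρ))
    {r l : ℝ} (hr : 0 < r) (hl : Tendsto (fun n => yn n r) atTop (nhds l)) : l = y r := by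
  have hρ : 0 ≤ ρ := ge_of_tendsto' hlim hρn
  obtain ⟨C, hC⟩ := exists_lipschitz_dependence hA (ρ + 1) hr
  refine tendsto_nhds_unique hl ?_
  rw [tendsto_iff_dist_tendsto_zero]
  have h1 : Tendsto (fun n => C * |ρn n - ρ|) atTop (nhds 0) := by
    have := (tendsto_iff_dist_tendsto_zero.1 hlim).const_mul C
    simpa [Real.dist_eq] using this
  refine squeeze_zero' (Eventually.of_forall fun _ => dist_nonneg) ?_ h1
  filter_upwards [hlim.eventually_le_const (lt_add_one ρ)] with n hle
  exact hC _ _ _ _ (hn n) h ⟨hρn n, hle⟩ ⟨hρ, by linarith⟩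

/-- Pointwise limits of regular solutions with initial values tending to infinity are singular. -/
theorem tendsto_atTop_of_tendsto_initial (hA : Admissible α p γ f) {ρn : ℕ → ℝ} {yn : ℕ → ℝ → ℝ}
    (hn : ∀ n, IsRegularSolution_s16 α p γ f (ρn n) (yn n)) (hρn : Tendsto ρn atTop atTop)
    {z : ℝ → ℝ} (hz : ∀ r, 0 < r → Tendsto (fun n => yn n r) atTop (nhds (z r))) :
    Tendsto z (nhdsWithin 0 (Ioi 0)) atTop := by
  have hσ := hA.scalingExponent_pos
  obtain ⟨M, hM1, hM⟩ := exists_lower_bound hA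
  rw [tendsto_atTop]
  intro b
  obtain ⟨E, hE, hlow⟩ := hM (max M (2 * (b + 1))) (le_max_left _ _)
  have hcont : Tendsto (fun r : ℝ => E * r ^ scalingExponent α p γ) (nhdsWithin 0 (Ioi 0))
      (nhds 0) := by
    have hc : ContinuousAt (fun r : ℝ => E * r ^ scalingExponent α p γ) 0 :=
      continuousAt_const.mul (continuousAt_id.rpow_const (Or.inr hσ.le))
    have := hc.tendsto
    simp only [zero_rpow hσ.ne', mul_zero] at this
    exact this.mono_left nhdsWithin_le_nhds
  filter_upwards [hcont.eventually_le_const one_pos, self_mem_nhdsWithin] with r hr1 hr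
  refine ge_of_tendsto (hz r hr) ?_
  filter_upwards [hρn.eventually_gt_atTop (max M (2 * (b + 1)))] with n hgt
  have := hlow _ _ (hn n) hgt r hr
  have := le_max_right M (2 * (b + 1))
  linarith

/-- A pointwise limit of regular solutions solves the first-order system. -/
theorem exists_limit_system (hA : Admissible α p γ f) {ρn : ℕ → ℝ} {yn : ℕ → ℝ → ℝ}
    (hn : ∀ n, IsRegularSolution_s16 α p γ f (ρn n) (yn n)) {z : ℝ → ℝ}
    (hz : ∀ r, 0 < r → Tendsto (fun n => yn n r) atTop (nhds (z r)))
    (hzc : ContinuousOn z (Ioi 0)) :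
    ∃ w : ℝ → ℝ, ∀ r, 0 < r → 0 < w r ∧
      HasDerivAt w (r ^ γ * Real.exp (f (z r))) r ∧
      HasDerivAt z (-(r ^ (-(α / p)) * w r ^ (1 / p))) r := by
  have hp := hA.p_pos
  obtain ⟨W, hW⟩ := exists_mass_bound hA
  obtain ⟨K, hK⟩ := exists_upper_bound hA
  obtain ⟨ω, -, φ, hφ, hω⟩ := (isCompact_Icc (a := (0 : ℝ)) (b := W 1)).tendsto_subseq
    (x := fun n => mass γ f (yn n) 1)
    fun n => ⟨(hn n).mass_nonneg hA zero_le_one, hW _ _ (hn n) 1 one_pos⟩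
  have hzφ : ∀ r, 0 < r → Tendsto (fun n => yn (φ n) r) atTop (nhds (z r)) :=
    fun r hr => (hz r hr).comp hφ.tendsto_atTop
  have hpos : ∀ {r : ℝ}, 0 < r → ∀ s ∈ uIcc 1 r, 0 < s := fun hr s hs =>
    (lt_min one_pos hr).trans_le hs.1
  have hdc : ContinuousOn (fun s => s ^ γ * Real.exp (f (z s))) (Ioi 0) :=
    (continuousOn_id.rpow_const fun _ hx => Or.inl (ne_of_gt hx)).mul
      ((Real.continuous_exp.comp hA.continuous).comp_continuousOn hzc)
  obtain ⟨w, hw⟩ : ∃ w : ℝ → ℝ, w = fun r => ω + ∫ s in (1 : ℝ)..r,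
    s ^ γ * Real.exp (f (z s)) := ⟨_, rfl⟩
  have hwlim : ∀ r, 0 < r → Tendsto (fun n => mass γ f (yn (φ n)) r) atTop (nhds (w r)) := by
    intro r hr
    have hm : 0 < min 1 r := lt_min one_pos hr
    have hI : Tendsto (fun n => ∫ s in (1 : ℝ)..r, s ^ γ * Real.exp (f (yn (φ n) s))) atTop
        (nhds (∫ s in (1 : ℝ)..r, s ^ γ * Real.exp (f (z s)))) := by
      refine intervalIntegral.tendsto_integral_filter_of_dominated_convergence
        (fun s => s ^ γ * Real.exp (f (K (min 1 r)))) (Eventually.of_forall fun n => ?_)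
        (Eventually.of_forall fun n => Eventually.of_forall fun s hs => ?_)
        ((intervalIntegral.intervalIntegrable_rpow' (by linarith [hA.gamma_pos])).mul_const _)
        (Eventually.of_forall fun s hs => ?_)
      · exact ((hn (φ n)).integrable_density hA zero_le_one hr.le).aestronglyMeasurable_restrict_uIoc
      · have hs0 := hpos hr s (uIoc_subset_uIcc hs)
        rw [Real.norm_of_nonneg (mul_nonneg (rpow_nonneg hs0.le _) (Real.exp_pos _).le)]
        refine mul_le_mul_of_nonneg_left (Real.exp_le_exp.2 (hA.strictMono.monotone ?_))
          (rpow_nonneg hs0.le _)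
        exact ((hn (φ n)).antitone hA hm.le hs.1.le).trans (hK _ _ (hn (φ n)) _ hm)
      · have hs0 := hpos hr s (uIoc_subset_uIcc hs)
        exact (((Real.continuous_exp.comp hA.continuous).tendsto (z s)).comp
          (hzφ s hs0)).const_mul _
    have := hω.add hI
    rw [hw]
    refine this.congr fun n => ?_
    exact ((hn (φ n)).mass_sub hA zero_le_one hr.le).symm
  have hwd : ∀ r, 0 < r → HasDerivAt w (r ^ γ * Real.exp (f (z r))) r := by
    intro r hr
    rw [hw]
    exact (intervalIntegral.integral_hasDerivAt_right
      ((hdc.mono fun s hs => hpos hr s hs).intervalIntegrable)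
      (hdc.stronglyMeasurableAtFilter isOpen_Ioi r hr)
      (hdc.continuousAt (Ioi_mem_nhds hr))).const_add ω
  have hwmono : StrictMonoOn w (Ioi 0) := by
    refine strictMonoOn_of_deriv_pos (convex_Ioi 0)
      (fun r hr => (hwd r hr).continuousAt.continuousWithinAt) fun r hr => ?_
    rw [interior_Ioi] at hr
    rw [(hwd r hr).deriv]
    exact mul_pos (rpow_pos_of_pos hr _) (Real.exp_pos _)
  have hwpos : ∀ r, 0 < r → 0 < w r := by
    intro r hr
    have h2 : 0 ≤ w (r / 2) := ge_of_tendsto' (hwlim _ (half_pos hr)) fun n =>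
      (hn (φ n)).mass_nonneg hA (half_pos hr).le
    exact h2.trans_lt (hwmono (half_pos hr) hr (half_lt_self hr))
  have hvc : ContinuousOn (fun t => t ^ (-(α / p)) * w t ^ (1 / p)) (Ioi 0) :=
    (continuousOn_id.rpow_const fun _ hx => Or.inl (ne_of_gt hx)).mul
      (ContinuousOn.rpow_const (fun r hr => (hwd r hr).continuousAt.continuousWithinAt)
        fun r hr => Or.inl (hwpos r hr).ne')
  have hzeq : ∀ r, 0 < r → z r = z 1 - ∫ t in (1 : ℝ)..r, t ^ (-(α / p)) * w t ^ (1 / p) := by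
    intro r hr
    obtain ⟨C, -, hC⟩ := exists_speed_bound hA (lt_min one_pos hr) (min_le_max (a := 1) (b := r))
    have hI : Tendsto (fun n => ∫ t in (1 : ℝ)..r, speed α p γ f (yn (φ n)) t) atTop
        (nhds (∫ t in (1 : ℝ)..r, t ^ (-(α / p)) * w t ^ (1 / p))) := by
      refine intervalIntegral.tendsto_integral_filter_of_dominated_convergence
        (fun _ => C) (Eventually.of_forall fun n => ?_)
        (Eventually.of_forall fun n => Eventually.of_forall fun s hs => ?_)
        intervalIntegrable_const (Eventually.of_forall fun s hs => ?_)
      · exact (((hn (φ n)).continuousOn_speed hA).mono fun s hs =>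
          hpos hr s (uIoc_subset_uIcc hs)).aestronglyMeasurable measurableSet_uIoc
      · exact hC _ _ (hn (φ n)) s (uIoc_subset_uIcc hs)
      · have hs0 := hpos hr s (uIoc_subset_uIcc hs)
        exact ((hwlim s hs0).rpow_const (Or.inl (hwpos s hs0).ne')).const_mul _
    refine tendsto_nhds_unique (hzφ r hr) (((hzφ 1 one_pos).sub hI).congr fun n => ?_)
    exact ((hn (φ n)).sub_eq_integral hA zero_le_one hr.le).symm
  refine ⟨w, fun r hr => ⟨hwpos r hr, hwd r hr, ?_⟩⟩
  refine ((intervalIntegral.integral_hasDerivAt_right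
    ((hvc.mono fun s hs => hpos hr s hs).intervalIntegrable)
    (hvc.stronglyMeasurableAtFilter isOpen_Ioi r hr)
    (hvc.continuousAt (Ioi_mem_nhds hr))).const_sub (z 1)).congr_of_eventuallyEq ?_
  filter_upwards [Ioi_mem_nhds hr] with s hs
  exact hzeq s hs

end IsRegularSolution_s16

/-- Proposition 3.2 and Corollary 3.1: under (B1)–(B3), the family of regular
solutions `u(·,ρ)`, `ρ ≥ 0`, is relatively compact in `C([r₁,r₂])` for every
`[r₁,r₂] ⊂ (0,∞)`; every locally uniform limit `u**` of a sequence `u(·,ρₙ)` is a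
strictly decreasing solution of `L(u) + e^{f(u)} = 0` on `(0,∞)`, singular
(`u**(r) → +∞` as `r → 0+`) if `ρₙ → +∞` and equal to the regular solution
`u(·,ρ̄)` if `ρₙ → ρ̄ < +∞`. -/
theorem stmt_16 (α β γ θ : ℝ) (hθ : θ = γ + 2 + β - α) (f : ℝ → ℝ)
    -- (B1)
    (hf : ContDiff ℝ 1 f) (hf' : ∀ u : ℝ, 0 < deriv f u)
    (hftop : Tendsto f atTop atTop)
    -- (B2)
    (hB2a : Tendsto (fun u : ℝ => Real.exp (f u / (β + 1)) / u) atTop atTop)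
    (hB2b : Tendsto (fun u : ℝ => u * deriv f u) atTop atTop)
    -- (B3)
    (hαβ : α > β + 1) (hβ : 0 < β + 1) (hθpos : 0 < θ)
    -- the family of regular solutions
    (u : ℝ → ℝ → ℝ)
    (hucont : ∀ ρ : ℝ, ContinuousOn (u ρ) (Ici 0))
    (hueq : ∀ ρ : ℝ, ∀ r, 0 ≤ r →
      u ρ r = ρ - ∫ t in (0:ℝ)..r, t ^ (-(α / (β + 1))) *
        (∫ s in (0:ℝ)..t, s ^ γ * Real.exp (f (u ρ s))) ^ ((1:ℝ) / (β + 1))) :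
    -- (i) relative compactness in C([r₁,r₂])
    (∀ r₁ r₂ : ℝ, 0 < r₁ → r₁ ≤ r₂ →
      ∀ ρn : ℕ → ℝ, (∀ n, 0 ≤ ρn n) →
        ∃ φ : ℕ → ℕ, ∃ v : ℝ → ℝ, StrictMono φ ∧ ContinuousOn v (Icc r₁ r₂) ∧
          TendstoUniformlyOn (fun n => u (ρn (φ n))) v atTop (Icc r₁ r₂)) ∧
    -- (ii) locally uniform limits are solutions, singular or regular
    (∀ ρn : ℕ → ℝ, (∀ n, 0 ≤ ρn n) → ∀ uss : ℝ → ℝ,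
      (∀ K : Set ℝ, IsCompact K → K ⊆ Ioi 0 →
        TendstoUniformlyOn (fun n => u (ρn n)) uss atTop K) →
      ((∀ r ∈ Ioi (0:ℝ), DifferentiableAt ℝ uss r) ∧
        StrictAntiOn uss (Ioi 0) ∧
        (∀ r, 0 < r →
          HasDerivAt (fun x : ℝ => x ^ α * |deriv uss x| ^ β * deriv uss x)
            (-(r ^ γ * Real.exp (f (uss r)))) r) ∧
        (Tendsto ρn atTop atTop → Tendsto uss (nhdsWithin 0 (Ioi 0)) atTop) ∧
        (∀ ρbar : ℝ, Tendsto ρn atTop (nhds ρbar) → ∀ r, 0 < r → uss r = u ρbar r))) := by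
  have hp : β + 1 ≠ 0 := hβ.ne'
  have hA : Admissible α (β + 1) γ f :=
    ⟨hβ, hαβ, by linarith, hf, strictMono_of_deriv_pos hf', hB2a, hB2b⟩
  have hu : ∀ ρ, IsRegularSolution_s16 α (β + 1) γ f ρ (u ρ) := fun ρ => ⟨hucont ρ, hueq ρ⟩
  refine ⟨fun r₁ r₂ h₁ h₁₂ ρn hρn =>
    IsRegularSolution_s16.exists_tendstoUniformlyOn_subseq hA h₁ h₁₂ (fun n => hu (ρn n)) hρn,
    fun ρn hρn uss hlim => ?_⟩
  have hz : ∀ r, 0 < r → Tendsto (fun n => u (ρn n) r) atTop (nhds (uss r)) := fun r hr =>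
    (hlim {r} isCompact_singleton (singleton_subset_iff.2 hr)).tendsto_at (mem_singleton r)
  have hzc : ContinuousOn uss (Ioi 0) := by
    intro r hr
    have hr0 : (0 : ℝ) < r := hr
    have hsub : Icc (r / 2) (r + 1) ⊆ Ioi 0 := fun x hx => (half_pos hr0).trans_le hx.1
    have hc := (hlim _ isCompact_Icc hsub).continuousOn (Frequently.of_forall fun n =>
      (hucont (ρn n)).mono (hsub.trans Ioi_subset_Ici_self))
    exact (hc.continuousAt (Icc_mem_nhds (half_lt_self hr0) (lt_add_one r))).continuousWithinAt
  obtain ⟨w, hw⟩ := IsRegularSolution_s16.exists_limit_system hA (fun n => hu (ρn n)) hz hzc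
  have hspeed : ∀ r, 0 < r → 0 < r ^ (-(α / (β + 1))) * w r ^ (1 / (β + 1)) := fun r hr =>
    mul_pos (rpow_pos_of_pos hr _) (rpow_pos_of_pos (hw r hr).1 _)
  refine ⟨fun r hr => (hw r hr).2.2.differentiableAt, ?_, fun r hr => ?_,
    fun h => IsRegularSolution_s16.tendsto_atTop_of_tendsto_initial hA (fun n => hu (ρn n)) h hz,
    fun ρbar h r hr => IsRegularSolution_s16.eq_of_tendsto_initial hA (fun n => hu (ρn n)) hρn
      (hu ρbar) h hr (hz r hr)⟩
  · refine strictAntiOn_of_deriv_neg (convex_Ioi 0) hzc fun r hr => ?_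
    rw [interior_Ioi] at hr
    rw [(hw r hr).2.2.deriv]
    exact neg_neg_of_pos (hspeed r hr)
  · refine (hw r hr).2.1.neg.congr_of_eventuallyEq ?_
    filter_upwards [Ioi_mem_nhds hr] with x hx
    have hx0 : (0 : ℝ) < x := hx
    have hv := hspeed x hx0
    rw [(hw x hx0).2.2.deriv, abs_neg, abs_of_pos hv, mul_neg, mul_assoc, ← rpow_add_one hv.ne',
      mul_rpow (rpow_nonneg hx0.le _) (rpow_nonneg (hw x hx0).1.le _), ← rpow_mul hx0.le,
      ← rpow_mul (hw x hx0).1.le, one_div_mul_cancel hp, rpow_one, neg_mul,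
      div_mul_cancel₀ _ hp, ← mul_assoc, ← rpow_add hx0, add_neg_cancel, rpow_zero, one_mul]
    rfl
end

section
/- Assume f : ℝ → ℝ is of class C¹ with f' > 0, f(u) → +∞ as u → +∞, ∫_u^{+∞} e^{−f(s)/(β+1)} ds < +∞ for every u, and α > β+1 > 0, θ := γ + 2 + β − α > 0. Let ρ ∈ ℝ and let u be a C² solution on [0,∞) of L(u) + e^{f(u)} = 0 with u(0) = ρ, u'(0) = 0. Define F(w) = ∫_w^{+∞} e^{−f(s)/(β+1)} ds, F₁(w) = (β+1) e^{−w/(β+1)} (so F₁^{−1}(t) = −(β+1) ln(t/(β+1))), ε_ρ = ( F(ρ)/F₁(1) )^{(β+1)/θ}, and ũ(s) = F₁^{−1}( ε_ρ^{−θ/(β+1)} F(u(ε_ρ s)) ). Then ũ is a C² solution of L(ũ)(s) + e^{ũ(s)} + s^{α−γ} |ũ'(s)|^{β+2} ( I(u(ε_ρ s))/(β+1) − 1 ) = 0 on (0,∞) with ũ(0) = 1 and ũ'(0) = 0, where I(w) = F(w) f'(w) e^{f(w)/(β+1)}. -/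
open Filter Set Real MeasureTheory

/-- The tail integral of a continuous integrable function is an antiderivative of its opposite. -/
theorem hasDerivAt_integral_Ici {g : ℝ → ℝ} (hg : Continuous g)
    (hint : ∀ w, IntegrableOn g (Ici w)) (w : ℝ) :
    HasDerivAt (fun w => ∫ s in Ici w, g s) (-g w) w := by
  have hIoi (v : ℝ) : IntegrableOn g (Ioi v) := (hint v).mono_set Ioi_subset_Ici_self
  have heq : (fun v => ∫ s in Ici v, g s) =
      fun v => (∫ s in Ioi w, g s) - ∫ s in w..v, g s := by
    funext v
    rw [integral_Ici_eq_integral_Ioi, eq_sub_iff_add_eq, add_comm]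
    exact intervalIntegral.integral_interval_add_Ioi (hIoi w) (hIoi v)
  rw [heq]
  exact (hg.integral_hasStrictDerivAt w w).hasDerivAt.const_sub _

/-- The tail integral of a positive integrable function is positive. -/
theorem integral_Ici_pos {g : ℝ → ℝ} (hpos : ∀ s, 0 < g s) {w : ℝ}
    (hint : IntegrableOn g (Ici w)) : 0 < ∫ s in Ici w, g s := by
  rw [setIntegral_pos_iff_support_of_nonneg_ae
    (Eventually.of_forall fun s => (hpos s).le) hint]
  have hsupp : Function.support g = univ := by
    ext s
    simpa using (hpos s).ne'
  simp [hsupp]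

/-- Lemma 4.1: the transformation `ũ(s) = F₁⁻¹(ε_ρ^{−θ/(β+1)} F(u(ε_ρ s)))`, with
`F(w) = ∫_w^∞ e^{−f(s)/(β+1)} ds`, `F₁(w) = (β+1)e^{−w/(β+1)}`
(so `F₁⁻¹(t) = −(β+1) ln(t/(β+1))`) and `ε_ρ = (F(ρ)/F₁(1))^{(β+1)/θ}`, takes a C²
solution `u` of `L(u) + e^{f(u)} = 0`, `u(0) = ρ`, `u'(0) = 0` to a C² solution of
`L(ũ) + e^{ũ} + s^{α−γ}|ũ'|^{β+2}(I(u(ε_ρ s))/(β+1) − 1) = 0` on `(0,∞)` with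
`ũ(0) = 1`, `ũ'(0) = 0`, where `I(w) = F(w) f'(w) e^{f(w)/(β+1)}`. -/
theorem stmt_17 (α β γ θ : ℝ) (hθ : θ = γ + 2 + β - α)
    (f : ℝ → ℝ) (hf : ContDiff ℝ 1 f) (hf' : ∀ u : ℝ, 0 < deriv f u)
    (hftop : Tendsto f atTop atTop)
    (hint : ∀ w : ℝ, IntegrableOn (fun s => Real.exp (-f s / (β + 1))) (Ici w))
    (hαβ : α > β + 1) (hβ : 0 < β + 1) (hθpos : 0 < θ)
    (ρ : ℝ) (u : ℝ → ℝ)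
    (husm : ContDiffOn ℝ 2 u (Ici 0))
    (hu0 : u 0 = ρ) (hu0' : HasDerivWithinAt u 0 (Ici 0) 0)
    (hode : ∀ r, 0 < r →
      HasDerivAt (fun x : ℝ => x ^ α * |deriv u x| ^ β * deriv u x)
        (-(r ^ γ * Real.exp (f (u r)))) r)
    (F : ℝ → ℝ) (hF : ∀ w, F w = ∫ s in Ici w, Real.exp (-f s / (β + 1)))
    (eps : ℝ)
    (heps : eps = (F ρ / ((β + 1) * Real.exp (-(1:ℝ) / (β + 1)))) ^ ((β + 1) / θ))
    (tu : ℝ → ℝ)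
    (htu : ∀ s, tu s = -(β + 1) * Real.log (eps ^ (-(θ / (β + 1))) * F (u (eps * s)) / (β + 1)))
    (Ifun : ℝ → ℝ)
    (hIfun : ∀ w, Ifun w = F w * deriv f w * Real.exp (f w / (β + 1))) :
    ContDiffOn ℝ 2 tu (Ici 0) ∧
    tu 0 = 1 ∧ HasDerivWithinAt tu 0 (Ici 0) 0 ∧
    ∀ s, 0 < s →
      HasDerivAt (fun x : ℝ => x ^ α * |deriv tu x| ^ β * deriv tu x)
        (-(s ^ γ * (Real.exp (tu s) +
          s ^ (α - γ) * |deriv tu s| ^ (β + 2) * (Ifun (u (eps * s)) / (β + 1) - 1)))) s := by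
  have hβ0 : β + 1 ≠ 0 := hβ.ne'
  have hgc : Continuous fun s => Real.exp (-f s / (β + 1)) := by
    have := hf.continuous
    fun_prop
  have hFeq : F = fun w => ∫ s in Ici w, Real.exp (-f s / (β + 1)) := funext hF
  have hFd (w : ℝ) : HasDerivAt F (-Real.exp (-f w / (β + 1))) w := by
    rw [hFeq]
    exact hasDerivAt_integral_Ici hgc hint w
  have hFpos (w : ℝ) : 0 < F w := by
    rw [hF]
    exact integral_Ici_pos (fun s => Real.exp_pos _) (hint w)
  have hFC : ContDiff ℝ 2 F := by
    rw [show (2 : WithTop ℕ∞) = 1 + 1 by norm_num, contDiff_succ_iff_deriv]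
    refine ⟨fun w => (hFd w).differentiableAt, by simp, ?_⟩
    rw [show deriv F = fun w => -Real.exp (-f w / (β + 1)) from funext fun w => (hFd w).deriv]
    exact (Real.contDiff_exp.comp (hf.neg.div_const _)).neg
  have hApos : 0 < F ρ / ((β + 1) * Real.exp (-(1:ℝ) / (β + 1))) :=
    div_pos (hFpos ρ) (mul_pos hβ (Real.exp_pos _))
  have hepos : 0 < eps := heps ▸ Real.rpow_pos_of_pos hApos _
  have hcpos : 0 < eps ^ (-(θ / (β + 1))) := Real.rpow_pos_of_pos hepos _
  have hc : eps ^ (-(θ / (β + 1))) =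
      (F ρ / ((β + 1) * Real.exp (-(1:ℝ) / (β + 1))))⁻¹ := by
    rw [heps, ← Real.rpow_mul hApos.le, ← Real.rpow_neg_one]
    congr 1
    field_simp
  have hlogpos (w : ℝ) : 0 < eps ^ (-(θ / (β + 1))) * F w / (β + 1) :=
    div_pos (mul_pos hcpos (hFpos w)) hβ
  have htu_eq : tu = fun s =>
      -(β + 1) * Real.log (eps ^ (-(θ / (β + 1))) * F (u (eps * s)) / (β + 1)) := funext htu
  have hmaps : MapsTo (fun s => eps * s) (Ici 0) (Ici (0 : ℝ)) :=
    fun s hs => mul_nonneg hepos.le hs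
  have hPhi (w : ℝ) : HasDerivAt
      (fun w => -(β + 1) * Real.log (eps ^ (-(θ / (β + 1))) * F w / (β + 1)))
      ((β + 1) * Real.exp (-f w / (β + 1)) / F w) w := by
    have h := ((((hFd w).const_mul (eps ^ (-(θ / (β + 1))))).div_const (β + 1)).log
      (hlogpos w).ne').const_mul (-(β + 1))
    refine h.congr_deriv ?_
    have := (hFpos w).ne'
    have := hcpos.ne'
    field_simp
  have hlin (s : ℝ) : HasDerivAt (fun s => eps * s) eps s := by
    simpa using (hasDerivAt_id s).const_mul eps
  have hud {r : ℝ} (hr : 0 < r) : HasDerivAt u (deriv u r) r :=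
    ((husm.contDiffAt (Ici_mem_nhds hr)).differentiableAt (by simp)).hasDerivAt
  have htud {s : ℝ} (hs : 0 < s) : HasDerivAt tu
      ((β + 1) * Real.exp (-f (u (eps * s)) / (β + 1)) / F (u (eps * s)) *
        (deriv u (eps * s) * eps)) s := by
    rw [htu_eq]
    exact (hPhi _).comp s ((hud (mul_pos hepos hs)).comp s (hlin s))
  refine ⟨?_, ?_, ?_, ?_⟩
  · rw [htu_eq]
    have h1 : ContDiffOn ℝ 2 (fun s => F (u (eps * s))) (Ici 0) :=
      hFC.comp_contDiffOn (husm.comp (contDiff_const.mul contDiff_id).contDiffOn hmaps)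
    exact contDiffOn_const.mul
      (((contDiffOn_const.mul h1).div_const _).log fun s _ => (hlogpos _).ne')
  · rw [htu, mul_zero, hu0, hc]
    have hval : (F ρ / ((β + 1) * Real.exp (-(1:ℝ) / (β + 1))))⁻¹ * F ρ / (β + 1) =
        Real.exp (-(1:ℝ) / (β + 1)) := by
      have := (hFpos ρ).ne'
      field_simp
    rw [hval, Real.log_exp]
    field_simp
  · rw [htu_eq]
    have h1 : HasDerivWithinAt (fun s => u (eps * s)) (0 * eps) (Ici 0) 0 := by
      refine HasDerivWithinAt.comp (h₂ := u) (h := fun s => eps * s) (s' := Ici 0) 0 ?_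
        (hlin 0).hasDerivWithinAt hmaps
      simpa using hu0'
    have h2 := (hPhi (u (eps * 0))).comp_hasDerivWithinAt 0 h1
    exact h2.congr_deriv (by ring)
  · intro s hs
    have hes : 0 < eps * s := mul_pos hepos hs
    set K : ℝ → ℝ := fun x =>
      (β + 1) * Real.exp (-f (u (eps * x)) / (β + 1)) / F (u (eps * x)) * eps with hK
    have hKpos (x : ℝ) : 0 < K x :=
      mul_pos (div_pos (mul_pos hβ (Real.exp_pos _)) (hFpos _)) hepos
    have hdtu {x : ℝ} (hx : 0 < x) : deriv tu x = K x * deriv u (eps * x) := by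
      rw [(htud hx).deriv, hK]
      ring
    have hKd : HasDerivAt K
        (K s * (deriv tu s / (β + 1) * (1 - Ifun (u (eps * s)) / (β + 1)))) s := by
      have hv : HasDerivAt (fun x => u (eps * x)) (deriv u (eps * s) * eps) s :=
        (hud hes).comp s (hlin s)
      have hfd : HasDerivAt f (deriv f (u (eps * s))) (u (eps * s)) :=
        (hf.differentiable (by simp) _).hasDerivAt
      have h := (((((hfd.comp s hv).neg.div_const (β + 1)).exp.const_mul (β + 1)).div
        ((hFd _).comp s hv) (hFpos _).ne').mul_const eps)
      refine h.congr_deriv ?_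
      have hne := (hFpos (u (eps * s))).ne'
      have hexp : Real.exp (-f (u (eps * s)) / (β + 1)) *
          Real.exp (f (u (eps * s)) / (β + 1)) = 1 := by
        rw [← Real.exp_add, neg_div, neg_add_cancel, Real.exp_zero]
      rw [hdtu hs, hIfun, hK]
      simp only [Function.comp, Pi.neg_apply]
      rw [neg_div] at hexp ⊢
      rw [Real.exp_neg] at hexp ⊢
      field_simp
      ring
    have hG : HasDerivAt (fun x => K x ^ (β + 1) * (eps ^ (-α) *
        ((eps * x) ^ α * |deriv u (eps * x)| ^ β * deriv u (eps * x)))) _ s :=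
      (hKd.rpow_const (p := β + 1) (Or.inl (hKpos s).ne')).mul
        (((hode _ hes).comp s (hlin s)).const_mul (eps ^ (-α)))
    have hflux {x : ℝ} (hx : 0 < x) : x ^ α * |deriv tu x| ^ β * deriv tu x =
        K x ^ (β + 1) * (eps ^ (-α) *
          ((eps * x) ^ α * |deriv u (eps * x)| ^ β * deriv u (eps * x))) := by
      rw [hdtu hx, abs_mul, abs_of_pos (hKpos x), Real.mul_rpow (hKpos x).le (abs_nonneg _),
        Real.mul_rpow hepos.le hx.le, Real.rpow_add_one (hKpos x).ne', Real.rpow_neg hepos.le]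
      have := (Real.rpow_pos_of_pos hepos α).ne'
      field_simp
    refine (hG.congr_of_eventuallyEq ?_).congr_deriv ?_
    · filter_upwards [Ioi_mem_nhds hs] with x hx using hflux hx
    have hexptu : Real.exp (tu s) =
        K s ^ (β + 1) * eps ^ (-α) * eps ^ γ * eps * Real.exp (f (u (eps * s))) := by
      have hlogK : Real.log (K s) = Real.log (β + 1) - f (u (eps * s)) / (β + 1) -
          Real.log (F (u (eps * s))) + Real.log eps := by
        have hne := (hFpos (u (eps * s))).ne'
        rw [hK, Real.log_mul (by positivity) hepos.ne', Real.log_div (by positivity) hne,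
          Real.log_mul hβ0 (Real.exp_pos _).ne', Real.log_exp]
        ring
      have hne := (hFpos (u (eps * s))).ne'
      nth_rewrite 3 [← Real.exp_log hepos]
      rw [htu, Real.log_div (mul_pos hcpos (hFpos _)).ne' hβ0, Real.log_mul hcpos.ne' hne,
        Real.log_rpow hepos, Real.rpow_def_of_pos (hKpos s), Real.rpow_def_of_pos hepos,
        Real.rpow_def_of_pos hepos, ← Real.exp_add, ← Real.exp_add, ← Real.exp_add,
        ← Real.exp_add, hlogK, hθ]
      congr 1
      field_simp
      ring
    have habs : |deriv tu s| ^ (β + 2) = |deriv tu s| ^ β * deriv tu s * deriv tu s := by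
      rcases eq_or_ne (deriv tu s) 0 with h0 | h0
      · rw [h0, abs_zero, Real.zero_rpow (by linarith)]
        ring
      · rw [Real.rpow_add (abs_pos.mpr h0), Real.rpow_two, sq_abs]
        ring
    have hpow : s ^ γ * s ^ (α - γ) = s ^ α := by
      rw [← Real.rpow_add hs]
      ring_nf
    have hKsub : K s ^ (β + 1 - 1) * K s = K s ^ (β + 1) := by
      rw [← Real.rpow_add_one (hKpos s).ne', sub_add_cancel]
    have hfl := hflux hs
    have hsum : -(s ^ γ * (Real.exp (tu s) + s ^ (α - γ) * |deriv tu s| ^ (β + 2) *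
        (Ifun (u (eps * s)) / (β + 1) - 1))) = -(s ^ γ * Real.exp (tu s)) +
        (s ^ α * |deriv tu s| ^ β * deriv tu s) * deriv tu s *
          (1 - Ifun (u (eps * s)) / (β + 1)) := by
      rw [habs, ← hpow]
      ring
    rw [hsum, hfl, hexptu, ← hKsub, Real.mul_rpow hepos.le hs.le (z := α),
      Real.mul_rpow hepos.le hs.le (z := γ)]
    field_simp
    ring
end

section
/- Assume (A1)–(A6). Let v*(t) = g(θ t + φ₁(t) + φ₂(t)) + η(t), where φ₁(t) = ln( θ^β ( g'(θt) + (β+1) g''(θt) ln g'(θt) )^β ), φ₂(t) = ln( θ (α/(β+1) − 1) ) + ln( g'(θt) + (β+1) g''(θt) ln g'(θt) ), and η is C¹ with η(t) = O(g''(θt)) and η'(t) = O(g''(θt)) as t → +∞. Set F(w) = ∫_w^{+∞} e^{−f(s)/(β+1)} ds, θ̂ = θ/(β+1), α̂ = α/(β+1) and A = θ̂ (α̂ − 1)^{1/(β+1)}. Then e^{θ̂ t} F(v*(t)) → A^{−1} as t → +∞; equivalently, v*(t) = F^{−1}( A^{−1} e^{−θ̂ t} (1 + ε(t)) ) with ε(t)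 → 0 as t → +∞. -/
open Filter Set Asymptotics Real MeasureTheory

/-- A function whose derivative tends to `0` at infinity is sublinear. -/
lemma isLittleO_id_of_tendsto_hasDerivAt_zero {L L' : ℝ → ℝ}
    (hL : ∀ᶠ x in atTop, HasDerivAt L (L' x) x) (hL' : Tendsto L' atTop (nhds 0)) :
    L =o[atTop] fun x : ℝ => x := by
  rw [isLittleO_iff]
  intro c hc
  have h1 : ∀ᶠ x in atTop, ‖L' x‖ ≤ c / 2 := by
    have := (tendsto_norm_zero.comp hL').eventually (eventually_le_nhds (half_pos hc))
    exact this
  obtain ⟨N, hN⟩ := eventually_atTop.1 (hL.and h1)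
  have h2 : ∀ᶠ x in atTop, ‖L N‖ + c / 2 * |N| ≤ c / 2 * x :=
    (tendsto_id.const_mul_atTop (half_pos hc)).eventually_ge_atTop _
  filter_upwards [eventually_ge_atTop N, eventually_ge_atTop 0, h2] with x hx hx0 h2
  have h3 := (convex_Ici N).norm_image_sub_le_of_norm_hasDerivWithin_le
    (fun y hy => (hN y hy).1.hasDerivWithinAt) (fun y hy => (hN y hy).2) self_mem_Ici hx
  have h4 : ‖L x‖ ≤ ‖L x - L N‖ + ‖L N‖ := by
    simpa using norm_add_le (L x - L N) (L N)
  rw [Real.norm_of_nonneg (sub_nonneg.2 hx)] at h3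
  rw [Real.norm_of_nonneg hx0]
  nlinarith [neg_abs_le N]

/-- If `a → 0` and `(a / b) * log b → 0` with `b > 0`, then `a / b → 0`. -/
lemma tendsto_div_zero_of_tendsto_div_mul_log {ι : Type*} {l : Filter ι} {a b : ι → ℝ}
    (hb : ∀ᶠ t in l, 0 < b t) (ha : Tendsto a l (nhds 0))
    (hab : Tendsto (fun t => a t / b t * log (b t)) l (nhds 0)) :
    Tendsto (fun t => a t / b t) l (nhds 0) := by
  have hlim : Tendsto (fun t => exp 1 * |a t| + |a t / b t * log (b t)|) l (nhds 0) := by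
    simpa using (ha.abs.const_mul (exp 1)).add hab.abs
  refine squeeze_zero_norm' ?_ hlim
  filter_upwards [hb] with t hbt
  rw [Real.norm_eq_abs]
  rcases le_total 1 |log (b t)| with h | h
  · rw [abs_mul]
    have : |a t / b t| * 1 ≤ |a t / b t| * |log (b t)| := by gcongr
    have : 0 ≤ exp 1 * |a t| := by positivity
    linarith
  · have h1 : exp (-1) ≤ b t := by
      rw [← exp_log hbt]
      exact exp_le_exp.2 (abs_le.1 h).1
    have h2 : |a t / b t| ≤ exp 1 * |a t| := by
      rw [abs_div, abs_of_pos hbt, div_le_iff₀ hbt]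
      have h3 : exp 1 * exp (-1) = 1 := by rw [← exp_add]; simp
      calc |a t| = exp 1 * |a t| * exp (-1) := by linear_combination -|a t| * h3
        _ ≤ exp 1 * |a t| * b t := by gcongr
    have : 0 ≤ |a t / b t * log (b t)| := abs_nonneg _
    linarith

section Inverse

variable {f g : ℝ → ℝ}

lemma strictMonoOn_Ici_of_forall_deriv_pos (hf : ContDiffOn ℝ 4 f (Ici 0))
    (hf' : ∀ u ∈ Ici (0 : ℝ), 0 < deriv f u) : StrictMonoOn f (Ici 0) :=
  strictMonoOn_of_deriv_pos (convex_Ici 0) hf.continuousOn fun u hu =>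
    hf' u (interior_subset hu)

lemma exists_pos_eq_of_lt (hf : ContDiffOn ℝ 4 f (Ici 0)) (hftop : Tendsto f atTop atTop)
    {x : ℝ} (hx : f 0 < x) : ∃ u, 0 < u ∧ f u = x := by
  obtain ⟨N, hN⟩ := eventually_atTop.1 (hftop.eventually_ge_atTop x)
  have hM : (0 : ℝ) ≤ max N 0 := le_max_right _ _
  obtain ⟨u, hu, rfl⟩ := intermediate_value_Icc hM
    (hf.continuousOn.mono Icc_subset_Ici_self) ⟨hx.le, hN _ (le_max_left _ _)⟩
  exact ⟨u, lt_of_le_of_ne hu.1 (by rintro rfl; exact lt_irrefl _ hx), rfl⟩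

lemma hasStrictDerivAt_leftInverse (hf : ContDiffOn ℝ 4 f (Ici 0))
    (hf' : ∀ u ∈ Ici (0 : ℝ), 0 < deriv f u) (hgf : ∀ u ∈ Ici (0 : ℝ), g (f u) = u)
    {u : ℝ} (hu : 0 < u) : HasStrictDerivAt g (deriv f u)⁻¹ (f u) := by
  have h1 : ContDiffAt ℝ 4 f u := hf.contDiffAt (Ici_mem_nhds hu)
  have h2 : HasStrictDerivAt f (deriv f u) u := h1.hasStrictDerivAt (by norm_num)
  refine h2.to_local_left_inverse (hf' u hu.le).ne' ?_
  filter_upwards [Ici_mem_nhds hu] with w hw using hgf w hw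

lemma differentiableAt_deriv_leftInverse (hf : ContDiffOn ℝ 4 f (Ici 0))
    (hf' : ∀ u ∈ Ici (0 : ℝ), 0 < deriv f u) (hftop : Tendsto f atTop atTop)
    (hgf : ∀ u ∈ Ici (0 : ℝ), g (f u) = u)
    {u : ℝ} (hu : 0 < u) : DifferentiableAt ℝ (deriv g) (f u) := by
  have h0 : f 0 < f u := strictMonoOn_Ici_of_forall_deriv_pos hf hf' self_mem_Ici hu.le hu
  have h1 : deriv g =ᶠ[nhds (f u)] fun x => (deriv f (g x))⁻¹ := by
    filter_upwards [Ioi_mem_nhds h0] with x hx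
    obtain ⟨w, hw, rfl⟩ := exists_pos_eq_of_lt hf hftop hx
    rw [hgf w hw.le, (hasStrictDerivAt_leftInverse hf hf' hgf hw).hasDerivAt.deriv]
  refine DifferentiableAt.congr_of_eventuallyEq ?_ h1
  have h2 : ContDiffAt ℝ 4 f u := hf.contDiffAt (Ici_mem_nhds hu)
  have h3 : DifferentiableAt ℝ (deriv f) (g (f u)) := by
    rw [hgf u hu.le]
    exact (h2.derivWithin (m := 1) (by norm_num)).differentiableAt (by norm_num)
  refine (h3.comp _ (hasStrictDerivAt_leftInverse hf hf' hgf hu).hasDerivAt.differentiableAt).inv ?_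
  simp only [Function.comp_apply, hgf u hu.le]
  exact (hf' u hu.le).ne'

lemma tendsto_leftInverse_atTop (hf : ContDiffOn ℝ 4 f (Ici 0))
    (hf' : ∀ u ∈ Ici (0 : ℝ), 0 < deriv f u) (hftop : Tendsto f atTop atTop)
    (hgf : ∀ u ∈ Ici (0 : ℝ), g (f u) = u) : Tendsto g atTop atTop := by
  refine tendsto_atTop.2 fun M => ?_
  filter_upwards [eventually_gt_atTop (f 0), eventually_ge_atTop (f (max M 0))] with x hx hxM
  obtain ⟨u, hu, rfl⟩ := exists_pos_eq_of_lt hf hftop hx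
  rw [hgf u hu.le]
  exact (le_max_left _ _).trans
    (((strictMonoOn_Ici_of_forall_deriv_pos hf hf').le_iff_le (le_max_right M 0) hu.le).1 hxM)

end Inverse

/-- Comparison of an improper integral with a vanishing primitive. -/
lemma tendsto_integral_Ici_div {E P r : ℝ → ℝ} {k : ℝ} (hk : 0 < k)
    (hE : ∀ᶠ u in atTop, 0 < E u) (hEc : ∀ᶠ u in atTop, ContinuousAt E u)
    (hP : ∀ᶠ u in atTop, HasDerivAt P (-(E u * (k - r u))) u)
    (hPpos : ∀ᶠ u in atTop, 0 < P u)
    (hP0 : Tendsto P atTop (nhds 0)) (hr : Tendsto r atTop (nhds 0)) :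
    Tendsto (fun w => (∫ s in Ici w, E s) / P w) atTop (nhds k⁻¹) := by
  have key : ∀ ε, 0 < ε → ε < k → ∀ᶠ w in atTop,
      (k + ε)⁻¹ ≤ (∫ s in Ici w, E s) / P w ∧ (∫ s in Ici w, E s) / P w ≤ (k - ε)⁻¹ := by
    intro ε hε hεk
    have hrε : ∀ᶠ u in atTop, |r u| ≤ ε := by
      have := (hr.abs).eventually (eventually_le_nhds (by simpa using hε))
      exact this
    obtain ⟨N, hN⟩ := eventually_atTop.1 (hE.and (hEc.and (hP.and (hPpos.and hrε))))
    filter_upwards [eventually_ge_atTop N] with w hw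
    have hd : ∀ x ∈ Ici w, HasDerivAt P (-(E x * (k - r x))) x :=
      fun x hx => (hN x (hw.trans hx)).2.2.1
    have hneg : ∀ x ∈ Ioi w, -(E x * (k - r x)) ≤ 0 := by
      intro x hx
      obtain ⟨h1, -, -, -, h2⟩ := hN x (hw.trans (le_of_lt hx))
      have := (abs_le.1 h2).2
      have : 0 ≤ E x * (k - r x) := mul_nonneg h1.le (by linarith)
      linarith
    have hint := integrableOn_Ioi_deriv_of_nonpos' hd hneg hP0
    have heq := integral_Ioi_of_hasDerivAt_of_nonpos' hd hneg hP0
    have hint' : IntegrableOn (fun x => E x * (k - r x)) (Ioi w) := by simpa using hint.neg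
    have heq' : ∫ x in Ioi w, E x * (k - r x) = P w := by
      rw [integral_neg] at heq; linarith
    have hEm : AEStronglyMeasurable E (volume.restrict (Ioi w)) := by
      refine ContinuousOn.aestronglyMeasurable (fun x hx => ?_) measurableSet_Ioi
      exact (hN x (hw.trans (le_of_lt hx))).2.1.continuousWithinAt
    have hlow : ∀ x ∈ Ioi w, (k - ε) * E x ≤ E x * (k - r x) := by
      intro x hx
      obtain ⟨h1, -, -, -, h2⟩ := hN x (hw.trans (le_of_lt hx))
      nlinarith [(abs_le.1 h2).2]
    have hupp : ∀ x ∈ Ioi w, E x * (k - r x) ≤ (k + ε) * E x := by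
      intro x hx
      obtain ⟨h1, -, -, -, h2⟩ := hN x (hw.trans (le_of_lt hx))
      nlinarith [(abs_le.1 h2).1]
    have hEint : IntegrableOn E (Ioi w) := by
      refine Integrable.mono' (hint'.const_mul (k - ε)⁻¹) hEm ?_
      filter_upwards [ae_restrict_mem measurableSet_Ioi] with x hx
      rw [Real.norm_of_nonneg (hN x (hw.trans (le_of_lt hx))).1.le, ← div_eq_inv_mul,
        le_div_iff₀ (sub_pos.2 hεk), mul_comm]
      exact hlow x hx
    have h1 := setIntegral_mono_on (hEint.const_mul (k - ε)) hint' measurableSet_Ioi hlow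
    have h2 := setIntegral_mono_on hint' (hEint.const_mul (k + ε)) measurableSet_Ioi hupp
    rw [integral_const_mul, heq'] at h1 h2
    have hPw := (hN w hw).2.2.2.1
    have hkε : 0 < k - ε := sub_pos.2 hεk
    have hkε' : 0 < k + ε := by linarith
    rw [integral_Ici_eq_integral_Ioi]
    constructor
    · rw [le_div_iff₀ hPw, inv_mul_le_iff₀ hkε']; exact h2
    · rw [div_le_iff₀ hPw, ← div_eq_inv_mul, le_div_iff₀ hkε, mul_comm]; exact h1
  have hc1 : Tendsto (fun ε : ℝ => (k + ε)⁻¹) (nhdsWithin 0 (Ioi 0)) (nhds k⁻¹) := by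
    have : ContinuousAt (fun ε : ℝ => (k + ε)⁻¹) 0 :=
      (continuousAt_const.add continuousAt_id).inv₀ (by simpa using hk.ne')
    simpa using this.tendsto.mono_left nhdsWithin_le_nhds
  have hc2 : Tendsto (fun ε : ℝ => (k - ε)⁻¹) (nhdsWithin 0 (Ioi 0)) (nhds k⁻¹) := by
    have : ContinuousAt (fun ε : ℝ => (k - ε)⁻¹) 0 :=
      (continuousAt_const.sub continuousAt_id).inv₀ (by simpa using hk.ne')
    simpa using this.tendsto.mono_left nhdsWithin_le_nhds
  have hsmall : ∀ᶠ ε : ℝ in nhdsWithin 0 (Ioi 0), 0 < ε ∧ ε < k := Ioo_mem_nhdsGT hk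
  rw [tendsto_order]
  constructor
  · intro a ha
    obtain ⟨ε, h1, h2, h3⟩ := ((hc1.eventually_const_lt ha).and hsmall).exists
    filter_upwards [key ε h2 h3] with w hw using h1.trans_le hw.1
  · intro a ha
    obtain ⟨ε, h1, h2, h3⟩ := ((hc2.eventually_lt_const ha).and hsmall).exists
    filter_upwards [key ε h2 h3] with w hw using hw.2.trans_lt h1

section Inverse

variable {f g : ℝ → ℝ}

lemma tendsto_integral_exp_neg_div {b : ℝ} (hb : 0 < b) (hf : ContDiffOn ℝ 4 f (Ici 0))
    (hf' : ∀ u ∈ Ici (0 : ℝ), 0 < deriv f u) (hftop : Tendsto f atTop atTop)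
    (hgf : ∀ u ∈ Ici (0 : ℝ), g (f u) = u)
    (hquot : Tendsto (fun t => deriv (deriv g) t / deriv g t) atTop (nhds 0))
    (hlog : (fun t => log (deriv g t)) =o[atTop] fun t : ℝ => t) :
    Tendsto (fun w => (∫ s in Ici w, exp (-f s / b)) / (exp (-f w / b) * deriv g (f w)))
      atTop (nhds b) := by
  have hg' : ∀ u, 0 < u → deriv g (f u) = (deriv f u)⁻¹ := fun u hu =>
    (hasStrictDerivAt_leftInverse hf hf' hgf hu).hasDerivAt.deriv
  have hfd : ∀ u, 0 < u → HasDerivAt f (deriv f u) u := fun u hu =>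
    ((hf.contDiffAt (Ici_mem_nhds hu)).differentiableAt (by norm_num)).hasDerivAt
  have h := tendsto_integral_Ici_div (E := fun s => exp (-f s / b))
    (P := fun w => exp (-f w / b) * deriv g (f w))
    (r := fun u => deriv (deriv g) (f u) / deriv g (f u)) (k := b⁻¹) (inv_pos.2 hb)
    (Eventually.of_forall fun u => exp_pos _) ?_ ?_ ?_ ?_ (hquot.comp hftop)
  · simpa using h
  · filter_upwards [eventually_gt_atTop 0] with u hu
    exact ((hfd u hu).continuousAt.neg.div_const b).rexp
  · filter_upwards [eventually_gt_atTop 0] with u hu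
    have h1 := ((hfd u hu).neg.div_const b).exp
    have h2 := (differentiableAt_deriv_leftInverse hf hf' hftop hgf hu).hasDerivAt.comp u (hfd u hu)
    have hne := (hf' u hu.le).ne'
    refine (h1.mul h2).congr_deriv ?_
    simp only [Function.comp_apply, Pi.neg_apply, hg' u hu]
    field_simp
    ring
  · filter_upwards [eventually_gt_atTop 0] with u hu
    rw [hg' u hu]
    have := hf' u hu.le
    positivity
  · have h1 : Tendsto (fun x => exp (-x / b) * deriv g x) atTop (nhds 0) := by
      have h2 : Tendsto (fun x : ℝ => -((2 * b)⁻¹ * x)) atTop atBot :=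
        tendsto_neg_atTop_atBot.comp (tendsto_id.const_mul_atTop (by positivity))
      refine squeeze_zero_norm' ?_ (tendsto_exp_atBot.comp h2)
      filter_upwards [eventually_gt_atTop (f 0), eventually_ge_atTop 0,
        hlog.bound (show 0 < (2 * b)⁻¹ by positivity)] with x hx hx0 hxl
      obtain ⟨u, hu, rfl⟩ := exists_pos_eq_of_lt hf hftop hx
      have hpos : 0 < deriv g (f u) := by rw [hg' u hu]; exact inv_pos.2 (hf' u hu.le)
      rw [Real.norm_of_nonneg (by positivity)]
      rw [Real.norm_of_nonneg hx0, Real.norm_eq_abs] at hxl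
      conv_lhs => rw [← exp_log hpos]
      rw [← exp_add]
      refine exp_le_exp.2 ?_
      have h3 := (abs_le.1 hxl).2
      have h4 : -f u / b = -(2 * ((2 * b)⁻¹ * f u)) := by field_simp
      linarith
    exact h1.comp hftop

/-- A perturbation of `g (T t)` which is negligible with respect to `g' (τ t)` moves the value of
the inverse function `f` by `o(1)`. -/
lemma tendsto_apply_leftInverse_add_sub {τ T η : ℝ → ℝ} (hf : ContDiffOn ℝ 4 f (Ici 0))
    (hf' : ∀ u ∈ Ici (0 : ℝ), 0 < deriv f u) (hftop : Tendsto f atTop atTop)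
    (hgf : ∀ u ∈ Ici (0 : ℝ), g (f u) = u)
    (hT : Tendsto T atTop atTop)
    (hratio : ∀ S : ℝ → ℝ, (∀ᶠ t in atTop, |S t - T t| ≤ 1) →
      Tendsto (fun t => deriv g (S t) / deriv g (τ t)) atTop (nhds 1))
    (hτ : ∀ᶠ t in atTop, 0 < deriv g (τ t))
    (hη : Tendsto (fun t => η t / deriv g (τ t)) atTop (nhds 0))
    (hv : Tendsto (fun t => g (T t) + η t) atTop atTop) :
    Tendsto (fun t => f (g (T t) + η t) - T t) atTop (nhds 0) := by
  have hmono := (strictMonoOn_Ici_of_forall_deriv_pos hf hf').monotoneOn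
  have hfg : ∀ x, f 0 < x → 0 < g x ∧ f (g x) = x := by
    intro x hx
    obtain ⟨u, hu, rfl⟩ := exists_pos_eq_of_lt hf hftop hx
    rw [hgf u hu.le]; exact ⟨hu, rfl⟩
  have hd : ∀ x, f 0 < x → HasDerivAt g (deriv g x) x := by
    intro x hx
    obtain ⟨u, hu, rfl⟩ := exists_pos_eq_of_lt hf hftop hx
    exact (hasStrictDerivAt_leftInverse hf hf' hgf hu).hasDerivAt.differentiableAt.hasDerivAt
  -- the increment of `g` over an interval of length `δ` to either side of `T t`
  have hincr : ∀ δ, 0 < δ → ∀ a : ℝ → ℝ, (∀ t, |a t - T t| ≤ 1 ∧ |a t + δ - T t| ≤ 1) →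
      ∀ᶠ t in atTop, |η t| ≤ g (a t + δ) - g (a t) := by
    intro δ hδ a ha
    have hex : ∀ t, ∃ ξ, |ξ - T t| ≤ 1 ∧
        (f 0 < a t → g (a t + δ) - g (a t) = deriv g ξ * δ) := by
      intro t
      by_cases h : f 0 < a t
      · obtain ⟨ξ, hξ, he⟩ := exists_hasDerivAt_eq_slope g (deriv g)
          (show a t < a t + δ by linarith)
          (fun x hx => (hd x (h.trans_le hx.1)).continuousAt.continuousWithinAt)
          (fun x hx => hd x (h.trans hx.1))
        refine ⟨ξ, ?_, fun _ => ?_⟩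
        · have h1 := abs_le.1 (ha t).1
          have h2 := abs_le.1 (ha t).2
          exact abs_le.2 ⟨by linarith [hξ.1], by linarith [hξ.2]⟩
        · rw [he, add_sub_cancel_left, div_mul_cancel₀ _ hδ.ne']
      · exact ⟨T t, by simp, fun h' => absurd h' h⟩
    choose ξ hξ1 hξ2 using hex
    have h1 : ∀ᶠ t in atTop, 1 / 2 < deriv g (ξ t) / deriv g (τ t) :=
      (hratio ξ (Eventually.of_forall hξ1)).eventually_const_lt (by norm_num)
    have h2 : ∀ᶠ t in atTop, |η t / deriv g (τ t)| < δ / 2 :=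
      hη.abs.eventually_lt_const (by simpa using hδ)
    filter_upwards [h1, h2, hτ, hT.eventually_gt_atTop (f 0 + 1)] with t h1 h2 hτ hTt
    rw [hξ2 t (by linarith [(abs_le.1 (ha t).1).1])]
    rw [lt_div_iff₀ hτ] at h1
    rw [abs_div, abs_of_pos hτ, div_lt_iff₀ hτ] at h2
    nlinarith
  rw [Metric.tendsto_nhds]
  intro ε hε
  obtain ⟨δ, hδ, hδε⟩ := exists_between (lt_min hε one_pos)
  have hδ1 : δ < 1 := hδε.trans_le (min_le_right _ _)
  have hup := hincr δ hδ T (fun t => by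
    constructor
    · simp
    · rw [add_sub_cancel_left, abs_of_pos hδ]; exact hδ1.le)
  have hlo := hincr δ hδ (fun t => T t - δ) (fun t => by
    constructor
    · rw [sub_sub_cancel_left, abs_neg, abs_of_pos hδ]; exact hδ1.le
    · simp)
  filter_upwards [hup, hlo, hT.eventually_gt_atTop (f 0 + 1), hv.eventually_ge_atTop 0]
    with t hup hlo hTt hvt
  rw [sub_add_cancel] at hlo
  obtain ⟨p1, q1⟩ := hfg (T t + δ) (by linarith)
  obtain ⟨p2, q2⟩ := hfg (T t - δ) (by linarith)
  have h1 : f (g (T t) + η t) ≤ f (g (T t + δ)) :=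
    hmono hvt p1.le (by linarith [le_abs_self (η t)])
  have h2 : f (g (T t - δ)) ≤ f (g (T t) + η t) :=
    hmono p2.le hvt (by linarith [neg_abs_le (η t)])
  rw [q1] at h1
  rw [q2] at h2
  rw [Real.dist_eq, sub_zero]
  exact (abs_le.2 ⟨by linarith, by linarith⟩).trans_lt (hδε.trans_le (min_le_left _ _))

end Inverse

/-- Lemma 4.3: under (A1)–(A6), for the singular solution
`v*(t) = g(θt + φ₁(t) + φ₂(t)) + η(t)` with `η, η' = O(g''(θt))`, one has
`e^{θ̂ t} F(v*(t)) → A⁻¹` as `t → +∞`, where `F(w) = ∫_w^∞ e^{−f(s)/(β+1)} ds`,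
`θ̂ = θ/(β+1)`, `α̂ = α/(β+1)` and `A = θ̂ (α̂ − 1)^{1/(β+1)}`. -/
theorem stmt_19 (α β γ θ : ℝ) (hθ : θ = γ + 2 + β - α) (f g : ℝ → ℝ)
    -- (A1): f is C⁴ on [0,∞), increasing, tending to +∞; g is its inverse
    (hf : ContDiffOn ℝ 4 f (Ici 0))
    (hf' : ∀ u ∈ Ici (0:ℝ), 0 < deriv f u)
    (hftop : Tendsto f atTop atTop)
    (hgf : ∀ u ∈ Ici (0:ℝ), g (f u) = u)
    (hfg : ∀ t ∈ Ici (f 0), f (g t) = t)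
    -- (A2)
    (hA2a : Tendsto (fun t => deriv (deriv g) t) atTop (nhds 0))
    (hA2b : ∀ ε : ℝ → ℝ, (ε =O[atTop] fun t => deriv (deriv g) t) →
      Tendsto (fun t => f (g t + ε t) / t) atTop (nhds 1))
    -- (A3)
    (hA3 : ∀ h : ℝ → ℝ, (h =o[atTop] fun t : ℝ => t) →
      Tendsto (fun t => deriv g t / deriv g (t + h t)) atTop (nhds 1))
    -- (A4)
    (hA4 : Tendsto (fun t => deriv (deriv g) t / deriv g t * Real.log (deriv g t))
      atTop (nhds 0))
    -- (A5)
    (hA5a : ∀ n : ℕ, n ≤ 2 →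
      (fun t => deriv (deriv (deriv g)) t * Real.log (deriv g t) ^ n)
        =O[atTop] fun t => deriv (deriv g) t)
    (hA5b : (fun t => deriv (deriv (deriv (deriv g))) t * Real.log (deriv g t))
        =O[atTop] fun t => deriv (deriv g) t)
    (hA5c : ∃ C : ℝ, ∀ᶠ t in atTop, ∀ s, t ≤ s →
      |deriv (deriv g) s| ≤ C * |deriv (deriv g) t|)
    (hA5d : ∀ h : ℝ → ℝ, (h =o[atTop] fun t : ℝ => t) →
      (fun t => deriv (deriv g) (t + h t)) =O[atTop] fun t => deriv (deriv g) t)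
    -- (A6)
    (hαβ : α > β + 1) (hβ : 0 ≤ β) (hθpos : 0 < θ)
    (η v : ℝ → ℝ)
    (hη1 : ContDiffOn ℝ 1 η (Ici 0))
    (hη2 : η =O[atTop] fun t => deriv (deriv g) (θ * t))
    (hη3 : deriv η =O[atTop] fun t => deriv (deriv g) (θ * t))
    (hv : ∀ t, v t =
      g (θ * t +
          Real.log (θ ^ β * (deriv g (θ * t) +
            (β + 1) * deriv (deriv g) (θ * t) * Real.log (deriv g (θ * t))) ^ β) +
          (Real.log (θ * (α / (β + 1) - 1)) +
            Real.log (deriv g (θ * t) +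
              (β + 1) * deriv (deriv g) (θ * t) * Real.log (deriv g (θ * t))))) +
        η t) :
    Tendsto
      (fun t => Real.exp (θ / (β + 1) * t) *
        ∫ s in Ici (v t), Real.exp (-f s / (β + 1)))
      atTop
      (nhds ((θ / (β + 1) * (α / (β + 1) - 1) ^ ((1:ℝ) / (β + 1)))⁻¹)) := by
  set b := β + 1 with hbdef
  have hb : 0 < b := by linarith
  set κ := α / b - 1 with hκdef
  have hκ : 0 < κ := sub_pos.2 ((one_lt_div hb).2 hαβ)
  -- basic facts on `g`
  have hgpos : ∀ᶠ x in atTop, 0 < deriv g x := by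
    filter_upwards [eventually_gt_atTop (f 0)] with x hx
    obtain ⟨u, hu, rfl⟩ := exists_pos_eq_of_lt hf hftop hx
    rw [(hasStrictDerivAt_leftInverse hf hf' hgf hu).hasDerivAt.deriv]
    exact inv_pos.2 (hf' u hu.le)
  have hgdiff : ∀ᶠ x in atTop, HasDerivAt (deriv g) (deriv (deriv g) x) x := by
    filter_upwards [eventually_gt_atTop (f 0)] with x hx
    obtain ⟨u, hu, rfl⟩ := exists_pos_eq_of_lt hf hftop hx
    exact (differentiableAt_deriv_leftInverse hf hf' hftop hgf hu).hasDerivAt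
  have hquot : Tendsto (fun t => deriv (deriv g) t / deriv g t) atTop (nhds 0) :=
    tendsto_div_zero_of_tendsto_div_mul_log hgpos hA2a hA4
  have hlog : (fun t => log (deriv g t)) =o[atTop] fun t : ℝ => t := by
    refine isLittleO_id_of_tendsto_hasDerivAt_zero ?_ hquot
    filter_upwards [hgpos, hgdiff] with x h1 h2 using h2.log h1.ne'
  have hgtop : Tendsto g atTop atTop := tendsto_leftInverse_atTop hf hf' hftop hgf
  have hθt : Tendsto (fun t : ℝ => θ * t) atTop atTop := tendsto_id.const_mul_atTop hθpos
  -- the correction factor `G`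
  set G : ℝ → ℝ := fun t => deriv g (θ * t) +
    b * deriv (deriv g) (θ * t) * log (deriv g (θ * t)) with hG
  have hGratio : Tendsto (fun t => G t / deriv g (θ * t)) atTop (nhds 1) := by
    have h1 : Tendsto (fun t => 1 + b * (deriv (deriv g) (θ * t) / deriv g (θ * t) *
        log (deriv g (θ * t)))) atTop (nhds 1) := by
      simpa using ((hA4.comp hθt).const_mul b).const_add 1
    refine h1.congr' ?_
    filter_upwards [hθt.eventually hgpos] with t ht
    simp only [hG]
    field_simp
  have hgθpos : ∀ᶠ t in atTop, 0 < deriv g (θ * t) := hθt.eventually hgpos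
  have hGpos : ∀ᶠ t in atTop, 0 < G t := by
    filter_upwards [hgθpos, hGratio.eventually_const_lt one_pos] with t h1 h2
    exact (div_pos_iff_of_pos_right h1).1 h2
  set T : ℝ → ℝ := fun t => θ * t + log (θ ^ β * G t ^ β) + (log (θ * κ) + log (G t)) with hTdef
  have hvT : ∀ t, v t = g (T t) + η t := hv
  have hTeq : ∀ᶠ t in atTop, T t = θ * t + (b * log θ + log κ + b * log (G t)) := by
    filter_upwards [hGpos] with t ht
    simp only [hTdef]
    rw [log_mul (by positivity) (by positivity), log_rpow hθpos, log_rpow ht,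
      log_mul hθpos.ne' hκ.ne', hbdef]
    ring
  have hconst : ∀ c : ℝ, (fun _ : ℝ => c) =o[atTop] fun t : ℝ => t := fun c =>
    isLittleO_const_id_atTop c
  have hlogG : (fun t => log (G t)) =o[atTop] fun t : ℝ => t := by
    have h1 : Tendsto (fun t => log (G t / deriv g (θ * t))) atTop (nhds 0) := by
      simpa using hGratio.log one_ne_zero
    have h2 : (fun t => log (G t / deriv g (θ * t))) =o[atTop] fun t : ℝ => t :=
      (h1.isBigO_one ℝ).trans_isLittleO (hconst 1)
    have h3 : (fun t => log (deriv g (θ * t))) =o[atTop] fun t : ℝ => t :=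
      (hlog.comp_tendsto hθt).trans_isBigO (isBigO_const_mul_self θ _ _)
    refine (h2.add h3).congr' ?_ EventuallyEq.rfl
    filter_upwards [hGpos, hgθpos] with t h1 h2
    rw [log_div h1.ne' h2.ne']
    ring
  have hTo : (fun t => T t - θ * t) =o[atTop] fun t : ℝ => t := by
    refine ((hconst (b * log θ + log κ)).add (hlogG.const_mul_left b)).congr' ?_ EventuallyEq.rfl
    filter_upwards [hTeq] with t ht
    rw [ht]; ring
  have hTtop : Tendsto T atTop atTop := by
    have h1 : ∀ᶠ t in atTop, θ / 2 * t ≤ T t := by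
      filter_upwards [hTo.bound (half_pos hθpos), eventually_ge_atTop 0] with t h1 h2
      rw [Real.norm_eq_abs, Real.norm_of_nonneg h2] at h1
      linarith [(abs_le.1 h1).1]
    exact tendsto_atTop_mono' _ h1 (tendsto_id.const_mul_atTop (half_pos hθpos))
  -- slow variation of `g'`
  have hratio : ∀ S : ℝ → ℝ, (∀ᶠ t in atTop, |S t - T t| ≤ 1) →
      Tendsto (fun t => deriv g (S t) / deriv g (θ * t)) atTop (nhds 1) := by
    intro S hS
    have h1 : (fun t => S t - θ * t) =o[atTop] fun t : ℝ => t := by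
      have h2 : (fun t => S t - T t) =o[atTop] fun t : ℝ => t := by
        refine IsBigO.trans_isLittleO (g := fun _ : ℝ => (1 : ℝ)) ?_ (hconst 1)
        refine IsBigO.of_bound 1 ?_
        filter_upwards [hS] with t ht
        simpa using ht
      simpa using h2.add hTo
    have hdiv : Tendsto (fun s : ℝ => s / θ) atTop atTop := tendsto_id.atTop_div_const hθpos
    have h3 : (fun s => S (s / θ) - s) =o[atTop] fun s : ℝ => s := by
      have h4 := (h1.comp_tendsto hdiv).trans_isBigO
        (k := fun s : ℝ => s) (by
          simp only [Function.comp_def, div_eq_inv_mul]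
          exact isBigO_const_mul_self θ⁻¹ _ _)
      refine h4.congr_left fun s => ?_
      simp only [Function.comp_apply]
      field_simp
    have h5 := ((hA3 _ h3).comp hθt).inv₀ one_ne_zero
    rw [inv_one] at h5
    refine h5.congr fun t => ?_
    simp only [Function.comp_apply]
    rw [inv_div, mul_div_cancel_left₀ _ hθpos.ne', add_sub_cancel]
  have hη0 : Tendsto η atTop (nhds 0) := hη2.trans_tendsto (hA2a.comp hθt)
  have hvtop : Tendsto (fun t => g (T t) + η t) atTop atTop :=
    (hgtop.comp hTtop).atTop_add hη0
  have hηq : Tendsto (fun t => η t / deriv g (θ * t)) atTop (nhds 0) := by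
    have h1 := hη2.mul (isBigO_refl (fun t => (deriv g (θ * t))⁻¹) atTop)
    exact h1.trans_tendsto (hquot.comp hθt)
  have hS := tendsto_apply_leftInverse_add_sub hf hf' hftop hgf hTtop hratio hgθpos hηq hvtop
  have hSratio := hratio (fun t => f (g (T t) + η t)) (by
    have := hS.abs.eventually_le_const (show |(0 : ℝ)| < 1 by simp)
    exact this)
  have hF := (tendsto_integral_exp_neg_div hb hf hf' hftop hgf hquot hlog).comp hvtop
  -- assembling the factors
  have hexp : Tendsto (fun t => exp (-(f (g (T t) + η t) - T t) / b)) atTop (nhds 1) := by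
    simpa using ((hS.neg.div_const b)).rexp
  have hall := ((hF.mul hexp).mul ((hSratio.div hGratio one_ne_zero))).const_mul
    (θ⁻¹ * (κ ^ (1 / b))⁻¹)
  have hval : θ⁻¹ * (κ ^ (1 / b))⁻¹ * (b * 1 * (1 / 1)) = (θ / b * κ ^ (1 / b))⁻¹ := by
    have : κ ^ (1 / b) ≠ 0 := (rpow_pos_of_pos hκ _).ne'
    field_simp
  rw [hval] at hall
  refine hall.congr' ?_
  filter_upwards [hGpos, hgθpos, hTeq, hSratio.eventually_const_lt one_pos] with t h1 h2 h3 h4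
  have h5 : 0 < deriv g (f (g (T t) + η t)) := (div_pos_iff_of_pos_right h2).1 h4
  simp only [Function.comp_apply, Pi.div_apply, hvT t]
  generalize (∫ s in Ici (g (T t) + η t), exp (-f s / b)) = I
  generalize f (g (T t) + η t) = S at h5 ⊢
  have hk : κ ^ (1 / b) = exp (log κ / b) := by
    rw [rpow_def_of_pos hκ, mul_one_div]
  have h6 : exp (θ / b * t) * exp (-S / b) * (θ * κ ^ (1 / b) * G t) = exp (-(S - T t) / b) := by
    have h7 : θ * κ ^ (1 / b) * G t = exp (log θ + log κ / b + log (G t)) := by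
      rw [exp_add, exp_add, exp_log hθpos, exp_log h1, hk]
    rw [h7, ← exp_add, ← exp_add, h3]
    congr 1
    field_simp
    ring
  rw [← h6]
  have : κ ^ (1 / b) ≠ 0 := (rpow_pos_of_pos hκ _).ne'
  field_simp
end
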